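/- arXiv:1501.07378 — 2 statements merged into one kernel-verified Lean document; each statement's English description precedes it below -/
import Mathlib

section
/- For μ = (μ_1, μ_2, μ_3), the super Yangian satisfies [[E_{1;i,j}(u), E_{2;h,k}(v)], E_{2;f,g}(w)] + [[E_{1;i,j}(u), E_{2;h,k}(w)], E_{2;f,g}(v)] = 0 in Y_{(μ_1,μ_2,μ_3)}[[u^{-1}, v^{-1}, w^{-1}]], for all admissible indices i,j,h,k,f,g. -/
noncomputable section

namespace SuperYangian

/-- The sign `(-1)^x` for `x : ZMod 2`. -/
def sgn (x : ZMod 2) : ℂ := if x = 0 then 1 else -1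

variable {A : Type*}

/-- The supercommutator `[x, y] = x*y - ε • (y*x)` with prescribed sign `ε`
(for homogeneous `x`, `y` one takes `ε = (-1)^{|x||y|}`). -/
def scomm [Ring A] [Algebra ℂ A] (ε : ℂ) (x y : A) : A := x * y - ε • (y * x)

/-- `off μ a = μ 0 + ⋯ + μ (a-1)`. -/
def off (μ : ℕ → ℕ) (a : ℕ) : ℕ := ∑ b ∈ Finset.range a, μ b

/-- A family `t i j r` (the coefficient of `u^{-r}` in `t_{ij}(u)`, with 0-based
indices `i j < d`) satisfying the defining RTT relations of the super Yangian
`Y(gl_{M|N})` with parity sequence `p`; the super Yangian itself, via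
`t_{i+1,j+1}^{(r)} = t i j r`, is the universal such family. -/
structure RTT (A : Type*) [Ring A] [Algebra ℂ A] (d : ℕ) (p : ℕ → ZMod 2) where
  t : ℕ → ℕ → ℕ → A
  t_zero : ∀ i j, t i j 0 = if i = j then (1 : A) else 0
  rtt : ∀ i j h k r s : ℕ, i < d → j < d → h < d → k < d →
    scomm (sgn ((p i + p j) * (p h + p k))) (t i j r) (t h k s) =
      sgn (p i * p j + p i * p h + p j * p h) •
        ∑ g ∈ Finset.range (min r s),
          (t h j g * t i k (r + s - 1 - g) - t h j (r + s - 1 - g) * t i k g)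

/-- Gauss decomposition data `T(u) = F(u) D(u) E(u)` with respect to the composition
`μ = (μ 0, …, μ (n-1))`, in coefficient form.  `E a b i j r` is the coefficient of
`u^{-r}` in the `(i,j)`-entry of the block `E_{a,b}(u)` (0-based blocks and entries),
extended by the identity on the diagonal blocks and by `0` below them; similarly `F`.
`D a` are the diagonal blocks and `D' a` their inverses.  Since the Gauss
decomposition is unique, this data consists exactly of the quasideterminant blocks. -/
structure Gauss [Ring A] [Algebra ℂ A] (T : ℕ → ℕ → ℕ → A) (n : ℕ) (μ : ℕ → ℕ) where
  D : ℕ → ℕ → ℕ → ℕ → A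
  D' : ℕ → ℕ → ℕ → ℕ → A
  E : ℕ → ℕ → ℕ → ℕ → ℕ → A
  F : ℕ → ℕ → ℕ → ℕ → ℕ → A
  E_diag : ∀ a i j r, E a a i j r = if i = j ∧ r = 0 then 1 else 0
  E_low : ∀ a b i j r, b < a → E a b i j r = 0
  E_zero : ∀ a b i j, a < b → E a b i j 0 = 0
  F_diag : ∀ a i j r, F a a i j r = if i = j ∧ r = 0 then 1 else 0
  F_high : ∀ a b i j r, a < b → F a b i j r = 0
  F_zero : ∀ a b i j, b < a → F a b i j 0 = 0
  D_zero : ∀ a i j, D a i j 0 = if i = j then (1 : A) else 0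
  D_inv : ∀ a i j r, a < n → i < μ a → j < μ a →
    ∑ q ∈ Finset.range (μ a), ∑ e ∈ Finset.range (r + 1), D a i q e * D' a q j (r - e) =
      if i = j ∧ r = 0 then 1 else 0
  D_inv' : ∀ a i j r, a < n → i < μ a → j < μ a →
    ∑ q ∈ Finset.range (μ a), ∑ e ∈ Finset.range (r + 1), D' a i q e * D a q j (r - e) =
      if i = j ∧ r = 0 then 1 else 0
  decomp : ∀ a b i j r, a < n → b < n → i < μ a → j < μ b →
    T (off μ a + i) (off μ b + j) r =
      ∑ c ∈ Finset.range n, ∑ q1 ∈ Finset.range (μ c), ∑ q2 ∈ Finset.range (μ c),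
        ∑ e1 ∈ Finset.range (r + 1), ∑ e2 ∈ Finset.range (r + 1 - e1),
          F a c i q1 e1 * D c q1 q2 e2 * E c b q2 j (r - e1 - e2)

/-- The sign `(-1)^x` as an element of a commutative ring `K`. -/
def sig (K : Type*) [CommRing K] (x : ZMod 2) : K := if x = 0 then 1 else -1

lemma sig_add (K : Type*) [CommRing K] : ∀ x y : ZMod 2, sig K (x + y) = sig K x * sig K y := by
  have h : ∀ x : ZMod 2, x = 0 ∨ x = 1 := by decide
  have h2 : (1 + 1 : ZMod 2) = 0 := by decide
  intro x y
  rcases h x with rfl | rfl <;> rcases h y with rfl | rfl <;> simp [sig, h2]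

lemma sig_mul_self (K : Type*) [CommRing K] (x : ZMod 2) : sig K x * sig K x = 1 := by
  unfold sig; split_ifs <;> simp

lemma sig_eq_one_or_neg_one (K : Type*) [CommRing K] (x : ZMod 2) :
    sig K x = 1 ∨ sig K x = -1 := by
  unfold sig; split_ifs <;> simp

lemma sig_zero (K : Type*) [CommRing K] : sig K 0 = 1 := by simp [sig]

lemma map_sig_smul {F K K' B B' : Type*} [CommRing K] [CommRing K'] [Ring B] [Ring B']
    [Algebra K B] [Algebra K' B'] [FunLike F B B'] [AddMonoidHomClass F B B']
    (f : F) (x : ZMod 2) (b : B) :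
    f (sig K x • b) = sig K' x • f b := by
  unfold sig; split_ifs <;> simp

section Abstract

variable {K B : Type*} [CommRing K] [Ring B] [Algebra K B]

/-- The supercommutator of elements of parities `a` and `b`. -/
def sbr (K : Type*) {B : Type*} [CommRing K] [Ring B] [Algebra K B]
    (a b : ZMod 2) (x y : B) : B := x * y - sig K (a * b) • (y * x)

lemma sbr_mul_right (a b b' : ZMod 2) (x y z : B) :
    sbr K a (b + b') x (y * z) = sbr K a b x y * z + sig K (a * b) • (y * sbr K a b' x z) := by
  simp only [sbr, mul_add, sig_add, mul_sub, sub_mul, smul_mul_assoc, mul_smul_comm, smul_sub,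
    smul_smul, mul_assoc]
  module

lemma sbr_mul_left (a a' b : ZMod 2) (x y z : B) :
    sbr K (a + a') b (x * y) z = x * sbr K a' b y z + sig K (a' * b) • (sbr K a b x z * y) := by
  simp only [sbr, add_mul, sig_add, mul_sub, sub_mul, smul_mul_assoc, mul_smul_comm, smul_sub,
    smul_smul, mul_assoc]
  module

lemma sbr_swap (a b : ZMod 2) (x y : B) :
    sbr K b a y x = -(sig K (a * b) • sbr K a b x y) := by
  have := sig_mul_self K (a * b)
  simp only [sbr, smul_sub, smul_smul, this, mul_comm b a]
  module

lemma sbr_jacobi {a b c : ZMod 2} {x y z : B} (h : sbr K a c x z = 0) :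
    sbr K (a + b) c (sbr K a b x y) z = sbr K a (b + c) x (sbr K b c y z) := by
  have h1 : x * z = sig K (a * c) • (z * x) := sub_eq_zero.mp h
  have h2 : ∀ w, x * (z * w) = sig K (a * c) • (z * (x * w)) := by
    intro w; rw [← mul_assoc, h1, smul_mul_assoc, mul_assoc]
  simp only [sbr, mul_add, add_mul, sig_add, mul_sub, sub_mul, smul_mul_assoc, mul_smul_comm,
    smul_sub, smul_smul, mul_assoc, h1, h2]
  module

lemma sbr_sum_right {ι : Type*} (s : Finset ι) (a b : ZMod 2) (x : B) (y : ι → B) :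
    sbr K a b x (∑ i ∈ s, y i) = ∑ i ∈ s, sbr K a b x (y i) := by
  simp [sbr, Finset.mul_sum, Finset.sum_mul, Finset.smul_sum]

lemma sbr_sum_left {ι : Type*} (s : Finset ι) (a b : ZMod 2) (x : ι → B) (y : B) :
    sbr K a b (∑ i ∈ s, x i) y = ∑ i ∈ s, sbr K a b (x i) y := by
  simp [sbr, Finset.mul_sum, Finset.sum_mul, Finset.smul_sum]

variable {ι : Type*} [Fintype ι] [DecidableEq ι]

lemma sbr_inverse_right {T₁ T₂ T₂' : Matrix ι ι B} {p : ι → ZMod 2} {c m : K}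
    (hr : T₂ * T₂' = 1) (hl : T₂' * T₂ = 1)
    (h : ∀ i j h k, c • sbr K (p i + p j) (p h + p k) (T₁ i j) (T₂ h k) =
      (m * sig K (p i * p j + p i * p h + p j * p h)) •
        (T₁ h j * T₂ i k - T₂ h j * T₁ i k)) (i j a l : ι) :
    c • sbr K (p i + p j) (p a + p l) (T₁ i j) (T₂' a l) =
      (m * sig K (p i * p j + p i * p a + p j * p a)) •
        ((if a = j then (T₁ * T₂') i l else 0) - if i = l then (T₂' * T₁) a j else 0) := by
  have hr' : ∀ h l, ∑ k, T₂ h k * T₂' k l = if h = l then 1 else 0 := fun h l => by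
    rw [← Matrix.mul_apply, hr, Matrix.one_apply]
  have hl' : ∀ h l, ∑ k, T₂' h k * T₂ k l = if h = l then 1 else 0 := fun h l => by
    rw [← Matrix.mul_apply, hl, Matrix.one_apply]
  have key : ∑ h, ∑ k, sig K ((p i + p j) * (p a + p h)) •
        (T₂' a h * (c • sbr K (p i + p j) (p h + p k) (T₁ i j) (T₂ h k)) * T₂' k l) =
      ∑ h, ∑ k, sig K ((p i + p j) * (p a + p h)) •
        (T₂' a h * ((m * sig K (p i * p j + p i * p h + p j * p h)) •
        (T₁ h j * T₂ i k - T₂ h j * T₁ i k)) * T₂' k l) := by simp only [h]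
  have e1 : ∀ h k, sig K ((p i + p j) * (p a + p h)) •
        (T₂' a h * (c • sbr K (p i + p j) (p h + p k) (T₁ i j) (T₂ h k)) * T₂' k l) =
        c • (sig K ((p i + p j) * (p a + p h)) • (T₂' a h * T₁ i j * (T₂ h k * T₂' k l))) -
        c • (sig K ((p i + p j) * (p a + p k)) • ((T₂' a h * T₂ h k) * (T₁ i j * T₂' k l))) := by
    intro h k
    have : sig K ((p i + p j) * (p a + p h)) * sig K ((p i + p j) * (p h + p k)) =
        sig K ((p i + p j) * (p a + p k)) := by
      rw [← sig_add]; congr 1; generalize p i = i; generalize p j = j; generalize p a = a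
      generalize p h = h; generalize p k = k; revert i j a h k; decide
    rw [← this]
    simp only [sbr, mul_sub, sub_mul, smul_mul_assoc, mul_smul_comm, smul_sub,
      smul_smul, mul_assoc]
    module
  have e2 : ∀ h k, sig K ((p i + p j) * (p a + p h)) •
        (T₂' a h * ((m * sig K (p i * p j + p i * p h + p j * p h)) •
        (T₁ h j * T₂ i k - T₂ h j * T₁ i k)) * T₂' k l) =
        (m * sig K (p i * p j + p i * p a + p j * p a)) •
        ((T₂' a h * T₁ h j) * (T₂ i k * T₂' k l)) -
        (m * sig K (p i * p j + p i * p a + p j * p a)) •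
          ((T₂' a h * T₂ h j) * (T₁ i k * T₂' k l)) := by
    intro h k
    have : sig K (p i * p j + p i * p a + p j * p a) = sig K ((p i + p j) * (p a + p h)) *
        sig K (p i * p j + p i * p h + p j * p h) := by
      rw [← sig_add]; congr 1; generalize p i = i; generalize p j = j; generalize p a = a
      generalize p h = h; revert i j a h; decide
    rw [this]
    simp only [mul_sub, sub_mul, smul_mul_assoc, mul_smul_comm, smul_sub,
      smul_smul, mul_assoc]
    module
  simp only [e1, e2, Finset.sum_sub_distrib, ← Finset.smul_sum] at key
  rw [Finset.sum_comm (f := fun h k => sig K ((p i + p j) * (p a + p k)) •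
    ((T₂' a h * T₂ h k) * (T₁ i j * T₂' k l)))] at key
  simp only [← Finset.smul_sum, ← Finset.mul_sum, ← Finset.sum_mul, hr', hl'] at key
  simp only [mul_ite, mul_one, mul_zero, ite_mul, one_mul, zero_mul, smul_ite, smul_zero,
    Finset.sum_ite_eq, Finset.sum_ite_eq', Finset.mem_univ, if_true,
    ← Matrix.mul_apply] at key
  rw [CharTwo.add_self_eq_zero, mul_zero, sig_zero, one_smul] at key
  have key' := congrArg Neg.neg key
  rw [neg_sub, neg_sub] at key'
  simpa only [sbr, smul_sub, smul_ite, smul_zero] using key'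

lemma sbr_inverse_inverse {T₁ T₁' T₂ T₂' : Matrix ι ι B} {p : ι → ZMod 2} {c m : K}
    (hr₁ : T₁ * T₁' = 1) (hl₁ : T₁' * T₁ = 1) (hr : T₂ * T₂' = 1) (hl : T₂' * T₂ = 1)
    (h : ∀ i j h k, c • sbr K (p i + p j) (p h + p k) (T₁ i j) (T₂ h k) =
      (m * sig K (p i * p j + p i * p h + p j * p h)) •
        (T₁ h j * T₂ i k - T₂ h j * T₁ i k)) (b e a l : ι) :
    c • sbr K (p b + p e) (p a + p l) (T₁' b e) (T₂' a l) =
      -((m * sig K (p a * p e + p a * p l + p e * p l)) •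
        (T₂' b l * T₁' a e - T₁' b l * T₂' a e)) := by
  have hr' : ∀ h l, ∑ k, T₁ h k * T₁' k l = if h = l then 1 else 0 := fun h l => by
    rw [← Matrix.mul_apply, hr₁, Matrix.one_apply]
  have hl' : ∀ h l, ∑ k, T₁' h k * T₁ k l = if h = l then 1 else 0 := fun h l => by
    rw [← Matrix.mul_apply, hl₁, Matrix.one_apply]
  have h' := sbr_inverse_right hr hl h
  have key : ∑ i, ∑ j, sig K ((p j + p e) * (p a + p l)) •
        (T₁' b i * (c • sbr K (p i + p j) (p a + p l) (T₁ i j) (T₂' a l)) * T₁' j e) =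
      ∑ i, ∑ j, sig K ((p j + p e) * (p a + p l)) •
        (T₁' b i * ((m * sig K (p i * p j + p i * p a + p j * p a)) •
          ((if a = j then (T₁ * T₂') i l else 0) - if i = l then (T₂' * T₁) a j else 0)) *
          T₁' j e) := by simp only [h']
  have e1 : ∀ i j, sig K ((p j + p e) * (p a + p l)) •
        (T₁' b i * (c • sbr K (p i + p j) (p a + p l) (T₁ i j) (T₂' a l)) * T₁' j e) =
        c • (sig K ((p j + p e) * (p a + p l)) • ((T₁' b i * T₁ i j) * (T₂' a l * T₁' j e))) -
        c • (sig K ((p i + p e) * (p a + p l)) •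
          ((T₁' b i * T₂' a l) * (T₁ i j * T₁' j e))) := by
    intro i j
    have : sig K ((p i + p e) * (p a + p l)) =
        sig K ((p j + p e) * (p a + p l)) * sig K ((p i + p j) * (p a + p l)) := by
      rw [← sig_add]; congr 1; generalize p i = i; generalize p j = j; generalize p e = e
      generalize p a + p l = a; revert i j a e; decide
    rw [this]
    simp only [sbr, mul_sub, sub_mul, smul_mul_assoc, mul_smul_comm, smul_sub,
      smul_smul, mul_assoc]
    module
  have e2 : ∀ i j, sig K ((p j + p e) * (p a + p l)) •
        (T₁' b i * ((m * sig K (p i * p j + p i * p a + p j * p a)) •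
          ((if a = j then (T₁ * T₂') i l else 0) - if i = l then (T₂' * T₁) a j else 0)) *
          T₁' j e) =
        (if a = j then (m * sig K (p a * p e + p a * p l + p e * p l)) •
          (T₁' b i * (T₁ * T₂') i l * T₁' a e) else 0) -
        (if i = l then (m * sig K (p a * p e + p a * p l + p e * p l)) •
          (T₁' b l * ((T₂' * T₁) a j * T₁' j e)) else 0) := by
    intro i j
    have h1 : a = j → sig K (p a * p e + p a * p l + p e * p l) =
        sig K ((p j + p e) * (p a + p l)) * sig K (p i * p j + p i * p a + p j * p a) := by
      rintro rfl
      rw [← sig_add]; congr 1; generalize p i = i; generalize p e = e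
      generalize p a = a; generalize p l = l; revert i l a e; decide
    have h2 : i = l → sig K (p a * p e + p a * p l + p e * p l) =
        sig K ((p j + p e) * (p a + p l)) * sig K (p i * p j + p i * p a + p j * p a) := by
      rintro rfl
      rw [← sig_add]; congr 1; generalize p i = i; generalize p e = e
      generalize p a = a; generalize p j = j; revert i j a e; decide
    rw [mul_smul_comm, smul_mul_assoc, smul_smul, mul_left_comm, mul_sub, sub_mul, smul_sub]
    congr 1
    · split_ifs with hh
      · rw [h1 hh, hh]
      · simp
    · split_ifs with hh
      · rw [h2 hh, hh, mul_assoc]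
      · simp
  simp only [e1, e2, Finset.sum_sub_distrib, ← Finset.smul_sum] at key
  rw [Finset.sum_comm (f := fun i j => sig K ((p j + p e) * (p a + p l)) •
    ((T₁' b i * T₁ i j) * (T₂' a l * T₁' j e)))] at key
  rw [Finset.sum_comm (f := fun i j => if i = l then (m * sig K (p a * p e + p a * p l + p e * p l))
    • (T₁' b l * ((T₂' * T₁) a j * T₁' j e)) else 0)] at key
  simp only [← Finset.smul_sum, ← Finset.mul_sum, ← Finset.sum_mul, hr', hl'] at key
  simp only [mul_ite, mul_one, mul_zero, ite_mul, one_mul, zero_mul, smul_ite, smul_zero,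
    Finset.sum_ite_eq, Finset.sum_ite_eq', Finset.mem_univ, if_true,
    ← Matrix.mul_apply, ← Finset.smul_sum, ← Finset.mul_sum, ← Finset.sum_mul] at key
  rw [← mul_assoc T₁', hl₁, Matrix.mul_assoc, hr₁, Matrix.one_mul, Matrix.mul_one,
    CharTwo.add_self_eq_zero, zero_mul, sig_zero, one_smul] at key
  have key' := congrArg Neg.neg key
  rw [neg_sub, ← smul_sub, ← smul_sub] at key'
  exact key'

end Abstract

section RowRelations

variable {K B B₀ : Type*} [CommRing K] [Ring B] [Algebra K B] [Ring B₀]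
variable {κ : Type*}

/-- The quadratic relation between two rows `x` and `w` (of parities `α` and `β`) of the inverse
of a matrix satisfying the RTT relation, evaluated at two values of the spectral parameter. -/
def RowRel (n m : K) (q : κ → ZMod 2) (α β : ZMod 2) (f f' : B₀ →+* B) (x w : κ → B₀) : Prop :=
  ∀ k g, n • sbr K (α + q k) (β + q g) (f (x k)) (f' (w g)) =
    -((m * sig K (β * q k + β * q g + q k * q g)) •
      (f' (x g) * f (w k) - f (x g) * f' (w k)))

lemma RowRel.flip {n m : K} (hn : ∀ b : B, n • b = 0 → b = 0) {q : κ → ZMod 2} {α β : ZMod 2}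
    {f f' : B₀ →+* B} {x w : κ → B₀} (h : RowRel n m q α β f f' x w)
    (h' : RowRel (-n) m q α β f' f x w) : RowRel n m q β α f f' w x := by
  intro k g
  have h1 := h k g
  have h2 := h' k g
  have h3 := h' g k
  have e : sbr K (α + q k) (β + q g) (f (x k)) (f' (w g)) =
      sbr K (α + q k) (β + q g) (f' (x k)) (f (w g)) := by
    refine sub_eq_zero.mp (hn _ ?_)
    rw [smul_sub, h1]
    rw [neg_smul] at h2
    rw [neg_eq_iff_eq_neg.mp h2]
    module
  have e1 : f (x k) * f' (w g) = sbr K (α + q k) (β + q g) (f (x k)) (f' (w g)) +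
    sig K ((α + q k) * (β + q g)) • (f' (w g) * f (x k)) := by simp [sbr]
  have e2 : f' (x k) * f (w g) = sbr K (α + q k) (β + q g) (f' (x k)) (f (w g)) +
    sig K ((α + q k) * (β + q g)) • (f (w g) * f' (x k)) := by simp [sbr]
  have hs : sig K (α * q k + α * q g + q k * q g) = sig K ((α + q g) * (β + q k)) *
      (sig K (β * q g + β * q k + q g * q k) * sig K ((α + q k) * (β + q g))) := by
    rw [← sig_add, ← sig_add]; congr 1; generalize q k = a; generalize q g = b
    generalize α = i; generalize β = j; revert i j a b; decide
  rw [neg_smul, neg_inj] at h3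
  rw [sbr_swap, smul_neg, smul_comm, h3, e1, e2, ← e, hs]
  module

/-- `RowRel` together with the same relation with the two spectral parameters exchanged. -/
def BiRowRel (n m : K) (q : κ → ZMod 2) (α β : ZMod 2) (f f' : B₀ →+* B) (x w : κ → B₀) : Prop :=
  RowRel n m q α β f f' x w ∧ RowRel (-n) m q α β f' f x w

lemma BiRowRel.flip {n m : K} (hn : ∀ b : B, n • b = 0 → b = 0) {q : κ → ZMod 2} {α β : ZMod 2}
    {f f' : B₀ →+* B} {x w : κ → B₀} (h : BiRowRel n m q α β f f' x w) :
    BiRowRel n m q β α f f' w x :=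
  ⟨RowRel.flip hn h.1 h.2, RowRel.flip (fun b hb => hn b (by rwa [neg_smul, neg_eq_zero] at hb))
    h.2 (by rw [neg_neg]; exact h.1)⟩

variable [Fintype κ] [DecidableEq κ]

lemma eq_sum_of_mul_right {δ : ZMod 2} {q : κ → ZMod 2} {d D : Matrix κ κ B} (h : d * D = 1)
    {E G : κ → B} (hE : ∀ k, ∑ r, sig K ((q r + q k) * δ) • (E r * d r k) = G k) (s : κ) :
    E s = ∑ k, sig K ((q k + q s) * δ) • (G k * D k s) := by
  have h0 : ∀ r s, ∑ k, d r k * D k s = if r = s then 1 else 0 := fun r s => by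
    rw [← Matrix.mul_apply, h, Matrix.one_apply]
  have e : ∀ k r, sig K ((q k + q s) * δ) • (sig K ((q r + q k) * δ) • (E r * d r k) * D k s) =
      sig K ((q r + q s) * δ) • (E r * (d r k * D k s)) := by
    intro k r
    have : sig K ((q r + q s) * δ) = sig K ((q k + q s) * δ) * sig K ((q r + q k) * δ) := by
      rw [← sig_add]; congr 1; generalize q r = a; generalize q s = b; generalize q k = c
      generalize δ = l; revert a b c l; decide
    rw [this, smul_mul_assoc, smul_smul, mul_assoc]
  simp only [← hE, Finset.sum_mul, Finset.smul_sum, e]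
  rw [Finset.sum_comm]
  simp only [← Finset.smul_sum, ← Finset.mul_sum, h0]
  simp [CharTwo.add_self_eq_zero, sig_zero]

variable {n m : K} {q : κ → ZMod 2} {α β : ZMod 2} {f f' : B₀ →+* B}

lemma sbr_strip_left {d D : Matrix κ κ B₀} (hd : d * D = 1) {x w X Y : κ → B₀}
    (hx : ∀ k, x k = ∑ r, X r * d r k) (hw : ∀ k, w k = ∑ r, Y r * d r k)
    (hxw : RowRel n m q α β f f' x w)
    (hdw : ∀ r, RowRel n m q (q r) β f f' (d r) w) (s g : κ) :
    n • sbr K (α + q s) (β + q g) (f (X s)) (f' (w g)) =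
      (m * sig K (β * q s + β * q g + q s * q g)) •
        ((∑ r, (f (X r) - f' (X r)) * f' (d r g)) * f (Y s)) := by
  have hfd : d.map f * D.map f = 1 := by
    rw [← Matrix.map_mul, hd, Matrix.map_one _ (map_zero f) (map_one f)]
  have key : ∀ k, ∑ r, sig K ((q r + q k) * (β + q g)) •
      ((n • sbr K (α + q r) (β + q g) (f (X r)) (f' (w g))) * d.map f r k) =
      (m * sig K (β * q k + β * q g + q k * q g)) •
        ((∑ r, (f (X r) - f' (X r)) * f' (d r g)) * f (w k)) := by
    intro k
    have e1 : n • sbr K (α + q k) (β + q g) (f (x k)) (f' (w g)) =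
        ∑ r, (f (X r) * (n • sbr K (q r + q k) (β + q g) (f (d r k)) (f' (w g))) +
          sig K ((q r + q k) * (β + q g)) •
      ((n • sbr K (α + q r) (β + q g) (f (X r)) (f' (w g))) * d.map f r k)) := by
      rw [hx, map_sum, sbr_sum_left, Finset.smul_sum]
      refine Finset.sum_congr rfl fun r _ => ?_
      have : α + q k = (α + q r) + (q r + q k) := by
        generalize q r = a; generalize q k = b; generalize α = i; revert i a b; decide
      rw [this, map_mul, sbr_mul_left, mul_smul_comm, smul_mul_assoc, Matrix.map_apply]
      module
    rw [Finset.sum_add_distrib, hxw k g] at e1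
    rw [← sub_eq_iff_eq_add'] at e1
    rw [← e1]
    simp only [fun r => hdw r k g, mul_neg, mul_smul_comm, Finset.sum_neg_distrib,
      ← Finset.smul_sum, mul_sub, sub_mul, ← mul_assoc, Finset.sum_sub_distrib, ← Finset.sum_mul]
    have e2 : ∑ r, f (X r) * f (d r g) = f (x g) := by rw [hx, map_sum]; simp
    have e3 : ∑ r, f' (X r) * f' (d r g) = f' (x g) := by rw [hx, map_sum]; simp
    rw [e2, e3]
    module
  rw [eq_sum_of_mul_right (q := q) hfd key s]
  have e : ∀ k, sig K ((q k + q s) * (β + q g)) • ((m * sig K (β * q k + β * q g + q k * q g)) •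
        ((∑ r, (f (X r) - f' (X r)) * f' (d r g)) * f (w k)) * D.map f k s) =
      (m * sig K (β * q s + β * q g + q s * q g)) •
        ((∑ r, (f (X r) - f' (X r)) * f' (d r g)) * f (w k * D k s)) := by
    intro k
    have : sig K (β * q s + β * q g + q s * q g) = sig K ((q k + q s) * (β + q g)) *
        sig K (β * q k + β * q g + q k * q g) := by
      rw [← sig_add]; congr 1; generalize q k = a; generalize q s = b; generalize q g = c
      generalize β = j; revert a b c j; decide
    rw [this, smul_mul_assoc, smul_smul, map_mul, mul_assoc, Matrix.map_apply]
    congr 1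
    ring
  simp only [e, ← Finset.smul_sum, ← Finset.mul_sum, ← map_sum]
  congr 3
  have h0 : ∀ r s, ∑ k, d r k * D k s = if r = s then 1 else 0 := fun r s => by
    rw [← Matrix.mul_apply, hd, Matrix.one_apply]
  simp only [hw, Finset.sum_mul]
  rw [Finset.sum_comm]
  simp [mul_assoc, ← Finset.mul_sum, h0]

lemma sbr_strip_unit {d D : Matrix κ κ B₀} (hd : d * D = 1) {x X : κ → B₀}
    (hx : ∀ k, x k = ∑ r, X r * d r k) {b : κ}
    (hxd : RowRel n m q α (q b) f f' x (d b))
    (hdd : ∀ r, RowRel n m q (q r) (q b) f f' (d r) (d b)) (s g : κ) :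
    n • sbr K (α + q s) (q b + q g) (f (X s)) (f' (d b g)) =
      if s = b then (m * sig K (q s)) • ∑ r, (f (X r) - f' (X r)) * f' (d r g) else 0 := by
  rw [sbr_strip_left hd hx (Y := fun r => if r = b then 1 else 0) (by simp) hxd hdd]
  split_ifs with h
  · subst h
    have : q s * q s + q s * q g + q s * q g = q s := by
      generalize q s = a; generalize q g = b; revert a b; decide
    simp [this]
  · simp

lemma sbr_strip {d D : Matrix κ κ B₀} (hd : d * D = 1) {x w X Y : κ → B₀}
    (hx : ∀ k, x k = ∑ r, X r * d r k) (hw : ∀ k, w k = ∑ r, Y r * d r k)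
    (hxw : RowRel n m q α β f f' x w)
    (hdw : ∀ r, RowRel n m q (q r) β f f' (d r) w)
    (hxd : ∀ r, RowRel n m q α (q r) f f' x (d r))
    (hwd : ∀ r, RowRel n m q β (q r) f f' w (d r))
    (hdd : ∀ r r', RowRel n m q (q r) (q r') f f' (d r) (d r')) (s t : κ) :
    (n * n) • sbr K (α + q s) (β + q t) (f (X s)) (f' (Y t)) =
      (n * m * sig K (β * q s + β * q t + q s * q t)) • ((f (X t) - f' (X t)) * f (Y s) -
        sig K ((α + q t) * (β + q s)) • (f' (Y s) * (f (X t) - f' (X t)))) -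
      (m * m) • ((f (X s) - f' (X s)) * (f (Y t) - f' (Y t))) := by
  have hfd : d.map f' * D.map f' = 1 := by
    rw [← Matrix.map_mul, hd, Matrix.map_one _ (map_zero f') (map_one f')]
  have hX := sbr_strip_left hd hx hw hxw hdw s
  have hXd := fun b => sbr_strip_unit hd hx (b := b) (hxd b) (fun r => hdd r b) s
  have hYd := fun b => sbr_strip_unit hd hw (b := b) (hwd b) (fun r => hdd r b) s
  suffices h : ∀ g, ∑ r, ((n * n) • sbr K (α + q s) (β + q r) (f (X s)) (f' (Y r))) *
        d.map f' r g = ∑ r, ((n * m * sig K (β * q s + β * q r + q s * q r)) •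
        ((f (X r) - f' (X r)) * f (Y s) -
        sig K ((α + q r) * (β + q s)) • (f' (Y s) * (f (X r) - f' (X r)))) -
      (m * m) • ((f (X s) - f' (X s)) * (f (Y r) - f' (Y r)))) * d.map f' r g by
    have := congrArg (fun v => Matrix.vecMul v (D.map f')) (funext h)
    have h2 : ∀ v : κ → B, (fun g => ∑ r, v r * d.map f' r g) = Matrix.vecMul v (d.map f') := by
      intro v; ext g; simp [Matrix.vecMul, dotProduct]
    simp only [h2, Matrix.vecMul_vecMul, hfd, Matrix.vecMul_one] at this
    exact congrFun this t
  intro g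
  have e1 : (n * n) • sbr K (α + q s) (β + q g) (f (X s)) (f' (w g)) =
      ∑ r, (((n * n) • sbr K (α + q s) (β + q r) (f (X s)) (f' (Y r))) * d.map f' r g +
        (n * sig K ((α + q s) * (β + q r))) •
          (f' (Y r) * (n • sbr K (α + q s) (q r + q g) (f (X s)) (f' (d r g))))) := by
    rw [hw, map_sum, sbr_sum_right, Finset.smul_sum]
    refine Finset.sum_congr rfl fun r _ => ?_
    have : β + q g = (β + q r) + (q r + q g) := by
      generalize q r = a; generalize q g = b; generalize β = j; revert j a b; decide
    rw [this, map_mul, sbr_mul_right, mul_smul_comm, smul_mul_assoc, Matrix.map_apply]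
    module
  simp only [Finset.sum_add_distrib, hXd, mul_ite, mul_zero, smul_ite, smul_zero,
    Finset.sum_ite_eq, Finset.mem_univ, if_true] at e1
  rw [← sub_eq_iff_eq_add, mul_smul, hX] at e1
  rw [← e1]
  have e2 : ∀ r, n • (f' (d r g) * f (Y s)) = sig K ((β + q s) * (q r + q g)) •
      (n • (f (Y s) * f' (d r g)) - if s = r then (m * sig K (q s)) •
        ∑ r, (f (Y r) - f' (Y r)) * f' (d r g) else 0) := by
    intro r
    have hh : f' (d r g) * f (Y s) = sig K ((β + q s) * (q r + q g)) •
        (f (Y s) * f' (d r g) - sbr K (β + q s) (q r + q g) (f (Y s)) (f' (d r g))) := by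
      simp [sbr, smul_smul, sig_mul_self]
    rw [← hYd r g, hh, smul_comm, smul_sub]
  have e3 : n • ((m * sig K (β * q s + β * q g + q s * q g)) •
        ((∑ r, (f (X r) - f' (X r)) * f' (d r g)) * f (Y s))) =
      ∑ r, ((n * m * sig K (β * q s + β * q r + q s * q r)) •
        ((f (X r) - f' (X r)) * f (Y s) * f' (d r g)) - if s = r then
        (m * m) • ((f (X s) - f' (X s)) * ∑ r, (f (Y r) - f' (Y r)) * f' (d r g)) else 0) := by
    rw [Finset.sum_mul, Finset.smul_sum, Finset.smul_sum]
    refine Finset.sum_congr rfl fun r _ => ?_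
    rw [smul_comm, mul_assoc, ← mul_smul_comm, e2]
    have h1 : sig K (β * q s + β * q r + q s * q r) = sig K (β * q s + β * q g + q s * q g) *
        sig K ((β + q s) * (q r + q g)) := by
      rw [← sig_add]; congr 1; generalize q r = a; generalize q g = b; generalize q s = c
      generalize β = j; revert j a b c; decide
    rw [h1]
    split_ifs with h
    · subst h
      have h2 : sig K (β * q s + β * q g + q s * q g) *
        sig K ((β + q s) * (q s + q g)) * sig K (q s) = 1 := by
        rw [← sig_add, ← sig_add, ← sig_zero K]; congr 1
        generalize q g = b; generalize q s = c
        generalize β = j; revert j b c; decide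
      rw [← one_smul K ((m * m) • _), ← h2]
      simp only [mul_sub, smul_sub, mul_smul_comm, smul_smul, mul_assoc]
      module
    · simp only [sub_zero, mul_smul_comm, smul_smul, mul_assoc]
      module
  have e4 : ∀ r, ((n * m * sig K (β * q s + β * q r + q s * q r)) •
        ((f (X r) - f' (X r)) * f (Y s) -
        sig K ((α + q r) * (β + q s)) • (f' (Y s) * (f (X r) - f' (X r)))) -
      (m * m) • ((f (X s) - f' (X s)) * (f (Y r) - f' (Y r)))) * d.map f' r g =
      (n * m * sig K (β * q s + β * q r + q s * q r)) •
        ((f (X r) - f' (X r)) * f (Y s) * f' (d r g)) -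
      (n * sig K ((α + q s) * (β + q s)) * (m * sig K (q s))) •
        (f' (Y s) * ((f (X r) - f' (X r)) * f' (d r g))) -
      (m * m) • ((f (X s) - f' (X s)) * ((f (Y r) - f' (Y r)) * f' (d r g))) := by
    intro r
    have h1 : sig K ((α + q s) * (β + q s)) = sig K (β * q s + β * q r + q s * q r) *
        sig K ((α + q r) * (β + q s)) * sig K (q s) := by
      rw [← sig_add, ← sig_add]; congr 1; generalize q r = a; generalize q s = c
      generalize α = i; generalize β = j; revert i j a c; decide
    have h2 := sig_mul_self K (q s)
    have h3 : n * sig K ((α + q s) * (β + q s)) * (m * sig K (q s)) =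
        n * m * sig K (β * q s + β * q r + q s * q r) * sig K ((α + q r) * (β + q s)) := by
      rw [h1]; linear_combination (n * m * sig K (β * q s + β * q r + q s * q r) *
        sig K ((α + q r) * (β + q s))) * h2
    rw [h3]
    simp only [Matrix.map_apply, sub_mul, smul_mul_assoc, mul_assoc, smul_sub, mul_sub, mul_smul]
  rw [e3, Finset.sum_congr rfl fun r _ => e4 r]
  simp only [Finset.sum_sub_distrib, Finset.sum_ite_eq, Finset.mem_univ, if_true,
    mul_smul_comm, smul_smul, ← Finset.smul_sum, ← Finset.mul_sum]
  abel

lemma sbr_strip_symm (hn : ∀ b : B, n • b = 0 → b = 0) (h2 : ∀ b : B, b + b = 0 → b = 0)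
    {d D : Matrix κ κ B₀} (hd : d * D = 1) {x w X Y : κ → B₀}
    (hx : ∀ k, x k = ∑ r, X r * d r k) (hw : ∀ k, w k = ∑ r, Y r * d r k)
    (hxw : BiRowRel n m q α β f f' x w)
    (hxd : ∀ r, BiRowRel n m q α (q r) f f' x (d r))
    (hwd : ∀ r, BiRowRel n m q β (q r) f f' w (d r))
    (hdd : ∀ r r', BiRowRel n m q (q r) (q r') f f' (d r) (d r')) (s t : κ) :
    (n * n - m * m) • (sbr K (α + q s) (β + q t) (f (X s)) (f' (Y t)) +
        sbr K (α + q s) (β + q t) (f' (X s)) (f (Y t))) =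
      (n * m * sig K (β * q s + β * q t + q s * q t)) •
        (sbr K (α + q t) (β + q s) (f (X t)) (f (Y s)) -
          sbr K (α + q t) (β + q s) (f' (X t)) (f' (Y s))) -
      (m * m) • (sbr K (α + q s) (β + q t) (f (X s)) (f (Y t)) +
          sbr K (α + q s) (β + q t) (f' (X s)) (f' (Y t))) := by
  have hwx := hxw.flip hn
  have a1 := sbr_strip hd hx hw hxw.1 (fun r => ((hwd r).flip hn).1) (fun r => (hxd r).1)
    (fun r => (hwd r).1) (fun r r' => (hdd r r').1) s t
  have a2 := sbr_strip hd hx hw hxw.2 (fun r => ((hwd r).flip hn).2) (fun r => (hxd r).2)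
    (fun r => (hwd r).2) (fun r r' => (hdd r r').2) s t
  have b1 := sbr_strip hd hw hx hwx.1 (fun r => ((hxd r).flip hn).1) (fun r => (hwd r).1)
    (fun r => (hxd r).1) (fun r r' => (hdd r r').1) t s
  have b2 := sbr_strip hd hw hx hwx.2 (fun r => ((hxd r).flip hn).2) (fun r => (hwd r).2)
    (fun r => (hxd r).2) (fun r r' => (hdd r r').2) t s
  rw [sbr_swap (α + q s) (β + q t)] at b1 b2
  have hs : sig K (α * q t + α * q s + q t * q s) = sig K ((α + q s) * (β + q t)) *
      (sig K (β * q s + β * q t + q s * q t) * sig K ((α + q t) * (β + q s))) := by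
    rw [← sig_add, ← sig_add]; congr 1; generalize q s = a; generalize q t = b
    generalize α = i; generalize β = j; revert i j a b; decide
  rw [hs, mul_comm (β + q s)] at b1 b2
  refine sub_eq_zero.mp (h2 _ ?_)
  simp only [sbr] at a1 a2 b1 b2 ⊢
  generalize sig K (β * q s + β * q t + q s * q t) = c at *
  rcases sig_eq_one_or_neg_one K ((α + q s) * (β + q t)) with e | e <;>
    rcases sig_eq_one_or_neg_one K ((α + q t) * (β + q s)) with e' | e' <;>
    simp only [e, e', mul_sub, sub_mul] at a1 a2 b1 b2 ⊢
  · linear_combination (norm := module) a1 + a2 - b1 - b2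
  · linear_combination (norm := module) a1 + a2 - b1 - b2
  · linear_combination (norm := module) a1 + a2 + b1 + b2
  · linear_combination (norm := module) a1 + a2 + b1 + b2

lemma map_sbr {K₀ : Type*} [CommRing K₀] [Algebra K₀ B₀] (f : B₀ →+* B) (a b : ZMod 2)
    (x y : B₀) : f (sbr K₀ a b x y) = sbr K a b (f x) (f y) := by
  simp only [sbr, map_sub, map_mul, map_sig_smul (K' := K)]

lemma sbr_strip_add_eq_zero (hn : ∀ b : B, n • b = 0 → b = 0)
    (hp : ∀ b : B, (n + m) • b = 0 → b = 0) (hm : ∀ b : B, (n - m) • b = 0 → b = 0)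
    (hp' : ∀ (b : B₀) (H : B), (n + m) • H = (m * m) • f b → b = 0)
    (hm' : ∀ (b : B₀) (H : B), (n - m) • H = (m * m) • f b → b = 0)
    (h2 : ∀ b : B, b + b = 0 → b = 0) (h2' : ∀ b : B₀, b + b = 0 → b = 0)
    {d D : Matrix κ κ B₀} (hd : d * D = 1) {x w X Y : κ → B₀}
    (hx : ∀ k, x k = ∑ r, X r * d r k) (hw : ∀ k, w k = ∑ r, Y r * d r k)
    (hxw : BiRowRel n m q α β f f' x w)
    (hxd : ∀ r, BiRowRel n m q α (q r) f f' x (d r))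
    (hwd : ∀ r, BiRowRel n m q β (q r) f f' w (d r))
    (hdd : ∀ r r', BiRowRel n m q (q r) (q r') f f' (d r) (d r')) (s t : κ) :
    sbr K (α + q s) (β + q t) (f (X s)) (f' (Y t)) +
        sbr K (α + q s) (β + q t) (f' (X s)) (f (Y t)) = 0 := by
  have a := sbr_strip_symm hn h2 hd hx hw hxw hxd hwd hdd s t
  have a' := sbr_strip_symm hn h2 hd hx hw hxw hxd hwd hdd t s
  have hc : sig K (β * q t + β * q s + q t * q s) = sig K (β * q s + β * q t + q s * q t) := by
    congr 1; ring
  rw [hc] at a'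
  simp only [← map_sbr (K₀ := ℤ) (K := K) f, ← map_sbr (K₀ := ℤ) (K := K) f'] at a a'
  generalize sbr K (α + q s) (β + q t) (f (X s)) (f' (Y t)) +
        sbr K (α + q s) (β + q t) (f' (X s)) (f (Y t)) = S at *
  generalize sbr K (α + q t) (β + q s) (f (X t)) (f' (Y s)) +
        sbr K (α + q t) (β + q s) (f' (X t)) (f (Y s)) = S' at *
  generalize sbr ℤ (α + q s) (β + q t) (X s) (Y t) = z at *
  generalize sbr ℤ (α + q t) (β + q s) (X t) (Y s) = z' at *
  have hz : z = 0 ∧ z' = 0 := by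
    rcases sig_eq_one_or_neg_one K (β * q s + β * q t + q s * q t) with e | e <;> rw [e] at a a'
    · have h1 : (z' - z) + (z' - z) = 0 := by
        refine hm' _ ((n + m) • (S - S') - m • f (z' - z) + m • f' (z' - z)) ?_
        simp only [map_add, map_sub]
        linear_combination (norm := module) a - a'
      have h3 : (z' + z) + (z' + z) = 0 := by
        refine hp' _ ((m - n) • (S + S') + m • f (z' + z) - m • f' (z' + z)) ?_
        simp only [map_add]
        linear_combination (norm := module) - a - a'
      have h4 : z = 0 := h2' _ (by linear_combination (norm := module) h2' _ h3 - h2' _ h1)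
      exact ⟨h4, by linear_combination (norm := module) h2' _ h1 + h4⟩
    · have h1 : (-z' - z) + (-z' - z) = 0 := by
        refine hm' _ ((n + m) • (S + S') - m • f (-z' - z) + m • f' (-z' - z)) ?_
        simp only [map_add, map_sub, map_neg]
        linear_combination (norm := module) a + a'
      have h3 : (-z' + z) + (-z' + z) = 0 := by
        refine hp' _ ((m - n) • (S - S') + m • f (-z' + z) - m • f' (-z' + z)) ?_
        simp only [map_add, map_neg]
        linear_combination (norm := module) - a + a'
      have h4 : z = 0 := h2' _ (by linear_combination (norm := module) h2' _ h3 - h2' _ h1)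
      exact ⟨h4, by linear_combination (norm := module) -h2' _ h1 - h4⟩
  obtain ⟨rfl, rfl⟩ := hz
  simp only [map_zero, sub_self, add_zero, smul_zero] at a
  refine hp _ (hm _ ?_)
  rw [smul_smul]
  linear_combination (norm := module) a

end RowRelations

section Series

open PowerSeries

variable {R : Type*} [Ring R]

lemma coeff_C_mul_map_C (r s : ℕ) (a b : R⟦X⟧) :
    coeff r (coeff s (C a * map C b : R⟦X⟧⟦X⟧)) = coeff r a * coeff s b := by
  rw [coeff_C_mul, coeff_map, coeff_mul_C]

lemma coeff_map_C_mul_C (r s : ℕ) (a b : R⟦X⟧) :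
    coeff r (coeff s (map C b * C a : R⟦X⟧⟦X⟧)) = coeff s b * coeff r a := by
  rw [coeff_mul_C, coeff_map, coeff_C_mul]

lemma X_sub_mul_sbr {a b a' b' : R⟦X⟧} {α β γ : ZMod 2}
    (h0 : ∀ s, sbr ℤ α β (coeff 0 a) (coeff s b) = 0)
    (h0' : ∀ r, sbr ℤ α β (coeff r a) (coeff 0 b) = 0)
    (h : ∀ r s, sbr ℤ α β (coeff (r + 1) a) (coeff s b) -
      sbr ℤ α β (coeff r a) (coeff (s + 1) b) =
      sig ℤ γ • (coeff r a' * coeff s b' - coeff s a' * coeff r b')) :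
    (X - C X) * sbr ℤ α β (C a) (map C b : R⟦X⟧⟦X⟧) =
        (C X * X) * (sig ℤ γ • (C a' * map C b' - map C a' * C b')) ∧
      (C X - X) * sbr ℤ α β (map C a) (C b : R⟦X⟧⟦X⟧) =
        (C X * X) * (sig ℤ γ • (map C a' * C b' - C a' * map C b')) := by
  have e1 : ∀ r s, coeff r (coeff s (sbr ℤ α β (C a) (map C b : R⟦X⟧⟦X⟧))) =
      sbr ℤ α β (coeff r a) (coeff s b) := fun r s => by
    simp only [sbr, map_sub, map_sig_smul (K' := ℤ), coeff_C_mul_map_C, coeff_map_C_mul_C]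
  have e2 : ∀ r s, coeff r (coeff s (sbr ℤ α β (map C a) (C b : R⟦X⟧⟦X⟧))) =
      sbr ℤ α β (coeff s a) (coeff r b) := fun r s => by
    simp only [sbr, map_sub, map_sig_smul (K' := ℤ), coeff_C_mul_map_C, coeff_map_C_mul_C]
  constructor
  · ext s r
    rw [sub_mul, mul_assoc, coeff_C_mul, map_sub, map_sub, coeff_C_mul]
    rcases s with _ | s <;> rcases r with _ | r <;>
      simp only [coeff_succ_X_mul, coeff_zero_X_mul, e1, h0, h0', map_zero, sub_zero,
        mul_zero]
    rw [h]
    simp only [map_sub, map_zsmul, coeff_C_mul_map_C, coeff_map_C_mul_C]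
  · ext s r
    rw [sub_mul, mul_assoc, coeff_C_mul, map_sub, map_sub, coeff_C_mul]
    rcases s with _ | s <;> rcases r with _ | r <;>
      simp only [coeff_succ_X_mul, coeff_zero_X_mul, e2, h0, h0', map_zero, sub_zero,
        mul_zero]
    rw [h]
    simp only [map_sub, map_zsmul, coeff_C_mul_map_C, coeff_map_C_mul_C]

lemma eq_zero_of_X_mul_sub_mul {c e : R} (hc : ∀ b, c * b = 0 → b = 0) {H : R⟦X⟧}
    (h : (X * C e - C c) * H = 0) : H = 0 := by
  have h1 := fun n => congrArg (coeff n) h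
  simp only [sub_mul, mul_assoc, map_sub, coeff_C_mul, map_zero] at h1
  ext n
  induction n with
  | zero => simpa using hc _ (by simpa using h1 0)
  | succ n ih =>
    refine hc _ ?_
    have := h1 (n + 1)
    rw [coeff_succ_X_mul, coeff_C_mul, ih] at this
    simpa using this

lemma eq_zero_of_X_mul_sub_mul_eq (z : ℤ) {b : R⟦X⟧} {H : R⟦X⟧⟦X⟧}
    (h : (X * C (1 + z • X) - C X) * H = (C X * X) * (C X * X) * C b) : b = 0 := by
  have hX : ∀ b : R⟦X⟧, X * b = 0 → b = 0 := fun b hb => by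
    ext n; simpa using congrArg (coeff (n + 1)) hb
  have h1 := fun n => congrArg (coeff n) h
  simp only [sub_mul, mul_assoc, map_sub, coeff_C_mul] at h1
  have H0 : coeff 0 H = 0 := hX _ (by simpa using h1 0)
  have H1 : coeff 1 H = 0 := hX _ (by
    have := h1 1
    rw [show (1 : ℕ) = 0 + 1 from rfl, coeff_succ_X_mul, coeff_succ_X_mul, coeff_C_mul, H0,
      coeff_C_mul, coeff_zero_X_mul] at this
    simpa using this)
  have H2 : coeff 2 H = -(X * b) := by
    have := h1 2
    rw [show (2 : ℕ) = 0 + 1 + 1 from rfl, coeff_succ_X_mul, coeff_succ_X_mul, coeff_C_mul,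
      coeff_C_mul, coeff_succ_X_mul, zero_add, H1, coeff_zero_C, mul_zero, zero_sub] at this
    have h3 := hX (coeff 2 H + X * b) (by rw [mul_add, ← this, neg_eq_iff_add_eq_zero.mp rfl])
    exact eq_neg_of_add_eq_zero_left h3
  have H3 : ∀ k, (1 + z • X) * coeff (k + 2) H = X * coeff (k + 3) H := by
    intro k
    have := h1 (k + 3)
    rw [show k + 3 = (k + 1) + 1 + 1 from rfl, coeff_succ_X_mul, coeff_succ_X_mul, coeff_C_mul,
      coeff_C_mul, coeff_succ_X_mul, coeff_succ_C, mul_zero, mul_zero] at this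
    exact sub_eq_zero.mp this
  have H4 : ∀ n k, coeff n (coeff (k + 2) H) = 0 := by
    intro n
    induction n with
    | zero =>
      intro k
      have := congrArg (coeff 0) (H3 k)
      rw [add_mul, one_mul, smul_mul_assoc, map_add, map_zsmul, coeff_zero_X_mul,
        coeff_zero_X_mul] at this
      simpa using this
    | succ n ih =>
      intro k
      have := congrArg (coeff (n + 1)) (H3 k)
      rw [add_mul, one_mul, smul_mul_assoc, map_add, map_zsmul, coeff_succ_X_mul,
        coeff_succ_X_mul, ih, ih (k + 1)] at this
      simpa using this
  refine hX _ (neg_eq_zero.mp ?_)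
  rw [← H2]
  ext n
  simpa using H4 n 0

end Series

section Quotient

variable {K B : Type*} [CommRing K] [Ring B] [Algebra K B]
variable {ι κ : Type*} [Fintype ι] [DecidableEq ι] [Fintype κ] [DecidableEq κ]

lemma sbr_quotient_inverse {T₁ T₂ T₂' : Matrix ι ι B} {p : ι → ZMod 2} {c m : K}
    (hr : T₂ * T₂' = 1) (hl : T₂' * T₂ = 1)
    (h : ∀ i j h k, c • sbr K (p i + p j) (p h + p k) (T₁ i j) (T₂ h k) =
      (m * sig K (p i * p j + p i * p h + p j * p h)) •
        (T₁ h j * T₂ i k - T₂ h j * T₁ i k))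
    (hc : ∀ b : B, c • b = 0 → b = 0) {g : κ → ι} {D : Matrix κ κ B} {e : κ → ι → B}
    (hD : ∀ i r, ∑ q, D i q * T₁ (g q) (g r) = if i = r then 1 else 0) {j a l : ι}
    (he : ∀ i, T₁ (g i) j = ∑ q, T₁ (g i) (g q) * e q j)
    (ha : a ∉ Set.range g) (hl' : l ∉ Set.range g) (i : κ) :
    c • sbr K (p (g i) + p j) (p a + p l) (e i j) (T₂' a l) =
      if a = j then (m * sig K (p j)) • ∑ q, D i q * (T₁ * T₂') (g q) l else 0 := by
  have h' := sbr_inverse_right hr hl h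
  have h0 : ∀ i q, sbr K (p (g i) + p (g q)) (p a + p l) (T₁ (g i) (g q)) (T₂' a l) = 0 := by
    intro i q
    refine hc _ ?_
    rw [h', if_neg fun hh => ha ⟨q, hh.symm⟩, if_neg fun hh => hl' ⟨i, hh⟩]
    simp
  have h1 : ∀ i, ∑ q, T₁ (g i) (g q) *
      (c • sbr K (p (g q) + p j) (p a + p l) (e q j) (T₂' a l)) =
      if a = j then (m * sig K (p j)) • (T₁ * T₂') (g i) l else 0 := by
    intro i
    have h2 := h' (g i) j a l
    rw [he, sbr_sum_left, Finset.smul_sum, if_neg fun hh => hl' ⟨i, hh⟩] at h2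
    have h3 : ∀ q, T₁ (g i) (g q) * (c • sbr K (p (g q) + p j) (p a + p l) (e q j) (T₂' a l)) =
        c • sbr K (p (g i) + p j) (p a + p l) (T₁ (g i) (g q) * e q j) (T₂' a l) := by
      intro q
      have : p (g i) + p j = (p (g i) + p (g q)) + (p (g q) + p j) := by
        generalize p (g i) = a; generalize p (g q) = b; generalize p j = c; revert a b c; decide
      rw [this, sbr_mul_left, h0]
      simp
    rw [Finset.sum_congr rfl fun q _ => h3 q, h2]
    split_ifs with hh
    · subst hh
      have : p (g i) * p a + p (g i) * p a + p a * p a = p a := by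
        generalize p (g i) = b; generalize p a = c; revert b c; decide
      rw [this, sub_zero]
    · simp
  calc _ = ∑ r, ∑ q, D i q * T₁ (g q) (g r) *
        (c • sbr K (p (g r) + p j) (p a + p l) (e r j) (T₂' a l)) := by
        simp only [← Finset.sum_mul, hD, ite_mul, one_mul, zero_mul, Finset.sum_ite_eq,
          Finset.mem_univ, if_true]
    _ = ∑ q, D i q * (if a = j then (m * sig K (p j)) • (T₁ * T₂') (g q) l else 0) := by
        rw [Finset.sum_comm]
        simp only [mul_assoc, ← Finset.mul_sum, h1]
    _ = _ := by split_ifs <;> simp [Finset.smul_sum]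

end Quotient

section RowRelations

variable {K B B₀ : Type*} [CommRing K] [Ring B] [Algebra K B] [Ring B₀]
variable {κ : Type*}

lemma RowRel.sbr_left {K₀ : Type*} [CommRing K₀] [Algebra K₀ B₀]
    {n m : K} {q : κ → ZMod 2} {α β γ δ : ZMod 2} {f f' : B₀ →+* B}
    {x w Q : κ → B₀} {e : B₀} (he : f e = f' e) (h : RowRel n m q α β f f' x w)
    (hx : ∀ k, sbr K₀ γ (α + q k) e (x k) = sig K₀ δ • Q k)
    (hw : ∀ k, sbr K₀ γ (β + q k) e (w k) = 0) :
    RowRel n m q (γ + α) β f f' Q w := by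
  intro k g
  have hQ : ∀ k, Q k = sig K₀ δ • sbr K₀ γ (α + q k) e (x k) := fun k => by
    rw [hx, smul_smul, sig_mul_self, one_smul]
  have hw1 : ∀ k, sbr K γ (β + q k) (f e) (f (w k)) = 0 := fun k => by
    rw [← map_sbr (K₀ := K₀), hw, map_zero]
  have hw2 : ∀ k, sbr K γ (β + q k) (f e) (f' (w k)) = 0 := fun k => by
    rw [he, ← map_sbr (K₀ := K₀), hw, map_zero]
  have hx1 : ∀ k, f (Q k) = sig K δ • sbr K γ (α + q k) (f e) (f (x k)) := fun k => by
    rw [← map_sbr (K₀ := K₀), hQ, map_sig_smul (K' := K)]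
  have hx2 : ∀ k, f' (Q k) = sig K δ • sbr K γ (α + q k) (f e) (f' (x k)) := fun k => by
    rw [he, ← map_sbr (K₀ := K₀), hQ, map_sig_smul (K' := K)]
  have e1 : ∀ y z : B, n • sbr K γ (α + q k + (β + q g)) y z =
      sbr K γ (α + q k + (β + q g)) y (n • z) := fun y z => by
    simp only [sbr, mul_smul_comm, smul_mul_assoc]; module
  have e2 : ∀ (a b : ZMod 2) (c : K) (y z : B), sbr K a b (c • y) z = c • sbr K a b y z := by
    intros; simp only [sbr, mul_smul_comm, smul_mul_assoc]; module
  have e3 : ∀ (a b : ZMod 2) (c : K) (y z z' : B), sbr K a b y (-(c • (z - z'))) =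
      -(c • (sbr K a b y z - sbr K a b y z')) := by
    intros; simp only [sbr, mul_smul_comm, smul_mul_assoc, mul_neg, neg_mul, mul_sub, sub_mul]
    module
  have e4 : α + q k + (β + q g) = (α + q g) + (β + q k) := by ring
  rw [hx1, add_assoc, e2, smul_comm, sbr_jacobi (hw2 g), e1, h k g, e3, e4, sbr_mul_right,
    sbr_mul_right, hw1, hw2, hx1, hx2]
  simp only [mul_zero, smul_zero, add_zero, smul_mul_assoc]
  module

end RowRelations

section CenterScalars

variable {B : Type*} [Ring B]

lemma center_smul_sbr [Algebra ℤ B] {n m : Subring.center B} {a b c : ZMod 2} {x y z : B}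
    (h : (n : B) * sbr ℤ a b x y = (m : B) * (sig ℤ c • z)) :
    n • sbr (Subring.center B) a b x y = (m * sig (Subring.center B) c) • z := by
  have h1 := map_sbr (K₀ := ℤ) (K := Subring.center B) (RingHom.id B) a b x y
  have h2 : sig ℤ c • z = sig (Subring.center B) c • z := by
    unfold sig; split_ifs <;> simp
  simp only [RingHom.id_apply] at h1
  rw [mul_smul, ← h1, ← h2]
  exact h

open PowerSeries

variable (R : Type*) [Ring R]

lemma X_mem_center : (X : R⟦X⟧) ∈ Subring.center R⟦X⟧ :=
  Subring.mem_center_iff.mpr fun φ => (commute_X φ).eq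

lemma C_mem_center {c : R} (hc : c ∈ Subring.center R) : C c ∈ Subring.center R⟦X⟧ :=
  Subring.mem_center_iff.mpr fun φ => by
    ext n
    rw [coeff_mul_C, coeff_C_mul, Subring.mem_center_iff.mp hc]

/-- The difference of the two variables of `R⟦X⟧⟦X⟧`. -/
def varDiff : Subring.center R⟦X⟧⟦X⟧ :=
  ⟨X - C X, sub_mem (X_mem_center _) (C_mem_center _ (X_mem_center R))⟩

/-- The product of the two variables of `R⟦X⟧⟦X⟧`. -/
def varMul : Subring.center R⟦X⟧⟦X⟧ :=
  ⟨C X * X, mul_mem (C_mem_center _ (X_mem_center R)) (X_mem_center _)⟩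

variable {R}

lemma X_mul_eq_zero {b : R⟦X⟧} (h : X * b = 0) : b = 0 := by
  ext n; simpa using congrArg (coeff (n + 1)) h

lemma varDiff_add_smul (z : ℤ) (b : R⟦X⟧⟦X⟧) :
    (varDiff R + z • varMul R) • b = (X * C (1 + z • X) - C X) * b := by
  rw [Subring.smul_def, smul_eq_mul]
  congr 1
  have : (C (X : R⟦X⟧) * X : R⟦X⟧⟦X⟧) = X * C X := (commute_X _).eq
  simp only [varDiff, varMul, Subring.coe_add, zsmul_eq_mul, Subring.coe_mul, map_add, map_mul,
    map_one, mul_add, mul_one, this, map_intCast, SubringClass.coe_intCast]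
  rw [(Int.cast_commute z (X : R⟦X⟧⟦X⟧)).symm.left_comm]
  abel

lemma varDiff_add_smul_eq_zero (z : ℤ) {b : R⟦X⟧⟦X⟧}
    (h : (varDiff R + z • varMul R) • b = 0) : b = 0 := by
  rw [varDiff_add_smul] at h
  exact eq_zero_of_X_mul_sub_mul (fun _ => X_mul_eq_zero) h

lemma varDiff_add_smul_eq (z : ℤ) {b : R⟦X⟧} {H : R⟦X⟧⟦X⟧}
    (h : (varDiff R + z • varMul R) • H = (varMul R * varMul R) • C b) : b = 0 := by
  rw [varDiff_add_smul] at h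
  exact eq_zero_of_X_mul_sub_mul_eq z h

end CenterScalars

section Main

open PowerSeries

variable {ι κ κ' : Type*} [Fintype ι] [DecidableEq ι] [Ring A]

/-- The RTT relation for a matrix of power series in the inverse of the spectral parameter, for
both orders of the two spectral parameters. -/
def SeriesRTT (p : ι → ZMod 2) (T : Matrix ι ι A⟦X⟧) : Prop :=
  ∀ i j h k,
    (X - C X) * sbr ℤ (p i + p j) (p h + p k) (C (T i j)) (map C (T h k) : A⟦X⟧⟦X⟧) =
      (C X * X) * (sig ℤ (p i * p j + p i * p h + p j * p h) •
        (C (T h j) * map C (T i k) - map C (T h j) * C (T i k))) ∧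
    (C X - X) * sbr ℤ (p i + p j) (p h + p k) (map C (T i j)) (C (T h k) : A⟦X⟧⟦X⟧) =
      (C X * X) * (sig ℤ (p i * p j + p i * p h + p j * p h) •
        (map C (T h j) * C (T i k) - C (T h j) * map C (T i k)))

variable {p : ι → ZMod 2} {T T' : Matrix ι ι A⟦X⟧}

lemma map_mul_map_eq_one {B : Type*} [Ring B] (f : A⟦X⟧ →+* B) (h : T * T' = 1) :
    T.map f * T'.map f = 1 := by
  rw [← Matrix.map_mul, h, Matrix.map_one _ (map_zero f) (map_one f)]

lemma map_C_comp_map_C (x : A⟦X⟧) :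
    map (C : A⟦X⟧ →+* A⟦X⟧⟦X⟧) (map C x) = map (map C) (map (C : A →+* A⟦X⟧) x) := by
  ext n : 1
  simp

/-- The entries of the inverse of a matrix satisfying the RTT relation satisfy quadratic relations,
here with the two spectral parameters taken to be the second and third variables. -/
lemma SeriesRTT.biRowRel (hr : T * T' = 1) (hl : T' * T = 1) (hT : SeriesRTT p T)
    (q : κ → ZMod 2) {g : κ → ι} (hq : ∀ k, q k = p (g k)) (b a : ι) :
    BiRowRel (varDiff A⟦X⟧) (varMul A⟦X⟧) q (p b) (p a) C (map C)
      (fun k => map C (T' b (g k))) (fun k => map C (T' a (g k))) := by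
  have hr₁ := map_mul_map_eq_one ((C : A⟦X⟧⟦X⟧ →+* A⟦X⟧⟦X⟧⟦X⟧).comp (map C)) hr
  have hl₁ := map_mul_map_eq_one ((C : A⟦X⟧⟦X⟧ →+* A⟦X⟧⟦X⟧⟦X⟧).comp (map C)) hl
  have hr₂ := map_mul_map_eq_one ((map (C : A⟦X⟧ →+* A⟦X⟧⟦X⟧)).comp (map C)) hr
  have hl₂ := map_mul_map_eq_one ((map (C : A⟦X⟧ →+* A⟦X⟧⟦X⟧)).comp (map C)) hl
  constructor
  · intro k l
    simp only [hq]
    refine sbr_inverse_inverse hr₁ hl₁ hr₂ hl₂ (fun i j h k => ?_) b (g k) a (g l)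
    apply center_smul_sbr
    have := congrArg (map (map C)) (hT i j h k).1
    simpa [map_sbr (K₀ := ℤ) (K := ℤ), map_sig_smul (K' := ℤ), varDiff, varMul, map_C_comp_map_C]
      using this
  · intro k l
    simp only [hq]
    refine sbr_inverse_inverse hr₂ hl₂ hr₁ hl₁ (fun i j h k => ?_) b (g k) a (g l)
    apply center_smul_sbr
    have := congrArg (map (map C)) (hT i j h k).2
    simpa [map_sbr (K₀ := ℤ) (K := ℤ), map_sig_smul (K' := ℤ), varDiff, varMul, map_C_comp_map_C]
      using this

variable [Fintype κ'] [DecidableEq κ']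

lemma SeriesRTT.exists_sbr_eq (hr : T * T' = 1) (hl : T' * T = 1) (hT : SeriesRTT p T)
    {g : κ' → ι} {D : Matrix κ' κ' A⟦X⟧} {e : κ' → ι → A⟦X⟧}
    (hD : ∀ i r, ∑ q, D i q * T (g q) (g r) = if i = r then 1 else 0)
    (he : ∀ j ∉ Set.range g, ∀ i, T (g i) j = ∑ q, T (g i) (g q) * e q j) (i : κ') {j₀ : ι}
    (hj₀ : j₀ ∉ Set.range g) :
    ∃ Q : ι → A⟦X⟧⟦X⟧, ∀ j ∉ Set.range g, ∀ a ∉ Set.range g, ∀ l ∉ Set.range g,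
      sbr (Subring.center A⟦X⟧⟦X⟧) (p (g i) + p j) (p a + p l) (C (e i j)) (map C (T' a l)) =
        if a = j then sig (Subring.center A⟦X⟧⟦X⟧) (p j) • Q l else 0 := by
  have hT' : ∀ i j h k, varDiff A • sbr (Subring.center A⟦X⟧⟦X⟧) (p i + p j) (p h + p k)
      (T.map C i j) (T.map (map C) h k) =
      (varMul A * sig (Subring.center A⟦X⟧⟦X⟧) (p i * p j + p i * p h + p j * p h)) •
        (T.map C h j * T.map (map C) i k - T.map (map C) h j * T.map C i k) := by
    intro i j h k
    apply center_smul_sbr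
    simpa [varDiff, varMul] using (hT i j h k).1
  have hn : ∀ b : A⟦X⟧⟦X⟧, varDiff A • b = 0 → b = 0 := fun b hb =>
    varDiff_add_smul_eq_zero 0 (by simpa using hb)
  have h1 : ∀ j ∉ Set.range g, ∀ a ∉ Set.range g, ∀ l ∉ Set.range g, varDiff A •
      sbr (Subring.center A⟦X⟧⟦X⟧) (p (g i) + p j) (p a + p l) (C (e i j)) (map C (T' a l)) =
      if a = j then (varMul A * sig (Subring.center A⟦X⟧⟦X⟧) (p j)) •
        ∑ q, C (D i q) * (T.map C * T'.map (map C)) (g q) l else 0 := by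
    intro j hj a ha l hl'
    have hD' : ∀ i r, ∑ q, (D.map C : Matrix κ' κ' A⟦X⟧⟦X⟧) i q * T.map C (g q) (g r) =
        if i = r then 1 else 0 := fun i r => by
      simp only [Matrix.map_apply, ← map_mul, ← map_sum, hD]
      split_ifs <;> simp
    have he' : ∀ i, T.map C (g i) j =
        ∑ q, T.map C (g i) (g q) * (Matrix.of e).map (C : A⟦X⟧ →+* A⟦X⟧⟦X⟧) q j := fun i => by
      simp only [Matrix.map_apply, ← map_mul, ← map_sum, Matrix.of_apply, ← he j hj]
    have := sbr_quotient_inverse (map_mul_map_eq_one (map (C : A →+* A⟦X⟧)) hr)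
      (map_mul_map_eq_one (map (C : A →+* A⟦X⟧)) hl) hT' hn hD' he' ha hl' i
    simpa only [Matrix.map_apply, Matrix.of_apply] using this
  refine ⟨fun l => sig (Subring.center A⟦X⟧⟦X⟧) (p j₀) • sbr (Subring.center A⟦X⟧⟦X⟧)
    (p (g i) + p j₀) (p j₀ + p l) (C (e i j₀)) (map C (T' j₀ l)), fun j hj a ha l hl' => ?_⟩
  refine sub_eq_zero.mp (hn _ ?_)
  rw [smul_sub, h1 j hj a ha l hl']
  split_ifs
  · rw [smul_comm (varDiff A), smul_comm (varDiff A), h1 j₀ hj₀ j₀ hj₀ l hl', if_pos rfl, mul_comm,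
      mul_comm _ (sig _ _), mul_smul, mul_smul, smul_smul (sig _ (p j₀)), sig_mul_self, one_smul,
      sub_self]
  · simp

lemma add_self_eq_zero_powerSeries {R : Type*} [Ring R] (h : ∀ b : R, b + b = 0 → b = 0)
    (b : R⟦X⟧) (hb : b + b = 0) : b = 0 := by
  ext n
  exact h _ (by simpa using congrArg (coeff n) hb)

variable [Fintype κ] [DecidableEq κ]

/-- Abstract form of the Serre-type relation: `e` is the first row of the upper unitriangular factor
of `T`, and `Y` is the last column of the inverse of that factor. -/
lemma SeriesRTT.sbr_sbr_add_eq_zero (h2 : ∀ b : A, b + b = 0 → b = 0)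
    (hr : T * T' = 1) (hl : T' * T = 1) (hT : SeriesRTT p T)
    {g₁ : κ' → ι} {D₁ : Matrix κ' κ' A⟦X⟧} {e : κ' → ι → A⟦X⟧}
    (hD₁ : ∀ i r, ∑ q, D₁ i q * T (g₁ q) (g₁ r) = if i = r then 1 else 0)
    (he : ∀ j ∉ Set.range g₁, ∀ i, T (g₁ i) j = ∑ q, T (g₁ i) (g₁ q) * e q j)
    {g₃ : κ → ι} (hg : ∀ k, g₃ k ∉ Set.range g₁) {d D : Matrix κ κ A⟦X⟧} (hd : d * D = 1)
    (hd' : D * d = 1) (hTd : ∀ r k, T' (g₃ r) (g₃ k) = d r k) {Y : ι → κ → A⟦X⟧}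
    (hY : ∀ a ∉ Set.range g₁, ∀ k, T' a (g₃ k) = ∑ r, Y a r * d r k)
    (hex : ∀ a ∉ Set.range g₁, ∃ j ∉ Set.range g₁, j ≠ a) (i : κ') {j h a : ι}
    (hj : j ∉ Set.range g₁) (hh : h ∉ Set.range g₁) (ha : a ∉ Set.range g₁)
    (hj' : ∀ r, g₃ r ≠ j) (k l : κ) {W : A⟦X⟧⟦X⟧}
    (hW : W = sbr (Subring.center A⟦X⟧⟦X⟧) (p (g₁ i) + p j) (p h + p (g₃ k)) (C (e i j))
      (map C (Y h k))) :
    sbr (Subring.center A⟦X⟧⟦X⟧⟦X⟧) (p (g₁ i) + p j + p h + p (g₃ k)) (p a + p (g₃ l))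
        (C W) (map C (map C (Y a l))) +
      sbr (Subring.center A⟦X⟧⟦X⟧⟦X⟧) (p (g₁ i) + p j + p h + p (g₃ k)) (p a + p (g₃ l))
        (map C W) (C (map C (Y a l))) = 0 := by
  have hdm := map_mul_map_eq_one (map (C : A →+* A⟦X⟧)) hd
  have hdm' := map_mul_map_eq_one (map (C : A →+* A⟦X⟧)) hd'
  obtain ⟨Q, hQ⟩ := hT.exists_sbr_eq hr hl hD₁ he i hj
  set P : κ → A⟦X⟧⟦X⟧ := Matrix.vecMul (fun k => Q (g₃ k)) (D.map (map C)) with hP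
  have hQP : ∀ k, Q (g₃ k) = ∑ r, P r * (d.map (map C) : Matrix κ κ A⟦X⟧⟦X⟧) r k := fun k => by
    have : Matrix.vecMul P (d.map (map C)) = fun k => Q (g₃ k) := by
      rw [hP, Matrix.vecMul_vecMul, hdm', Matrix.vecMul_one]
    exact (congrFun this k).symm
  have hYm : ∀ a ∉ Set.range g₁, ∀ k, map (C : A →+* A⟦X⟧) (T' a (g₃ k)) =
      ∑ r, map C (Y a r) * (d.map (map C) : Matrix κ κ A⟦X⟧⟦X⟧) r k := fun a ha k => by
    simp [hY a ha]
  have hWP : W = if h = j then sig (Subring.center A⟦X⟧⟦X⟧) (p j) • P k else 0 := by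
    have h1 : Matrix.vecMul (fun r => sbr (Subring.center A⟦X⟧⟦X⟧) (p (g₁ i) + p j)
        (p h + p (g₃ r)) (C (e i j)) (map C (Y h r))) (d.map (map C)) = fun k =>
        if h = j then sig (Subring.center A⟦X⟧⟦X⟧) (p j) • Q (g₃ k) else 0 := by
      funext k
      rw [← hQ j hj h hh _ (hg k), hYm h hh, sbr_sum_right]
      refine Finset.sum_congr rfl fun r _ => ?_
      have e1 : p h + p (g₃ k) = (p h + p (g₃ r)) + (p (g₃ r) + p (g₃ k)) := by
        generalize p h = a; generalize p (g₃ k) = b; generalize p (g₃ r) = c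
        revert a b c; decide
      rw [e1, sbr_mul_right, Matrix.map_apply, ← hTd, hQ j hj _ (hg r) _ (hg k), if_neg (hj' r),
        mul_zero, smul_zero, add_zero, hTd]
      rfl
    have h3 := congrArg (fun v => Matrix.vecMul v (D.map (map C)) k) h1
    simp only [Matrix.vecMul_vecMul, hdm, Matrix.vecMul_one] at h3
    rw [hW, h3]
    split_ifs
    · rw [hP, ← Pi.smul_apply, ← Matrix.smul_vecMul]
      rfl
    · simp [Matrix.vecMul, dotProduct]
  rw [hWP]
  split_ifs with hhj
  swap
  · simp [sbr]
  subst hhj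
  have hx : ∀ a ∉ Set.range g₁, BiRowRel (varDiff A⟦X⟧) (varMul A⟦X⟧) (fun k => p (g₃ k))
      (p (g₁ i)) (p a) C (map C) (fun k => Q (g₃ k)) (fun k => map C (T' a (g₃ k))) := by
    intro a ha
    obtain ⟨j', hj'₁, hj'₂⟩ := hex a ha
    have e1 : p (g₁ i) = (p (g₁ i) + p j') + p j' := by
      generalize p j' = a; generalize p (g₁ i) = b; revert a b; decide
    have e2 := hT.biRowRel hr hl (fun k => p (g₃ k)) (fun _ => rfl) j' a
    rw [e1]
    have hx := fun k => by simpa using hQ j' hj'₁ j' hj'₁ _ (hg k)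
    have hw := fun k => by simpa [Ne.symm hj'₂] using hQ j' hj'₁ a ha _ (hg k)
    exact ⟨e2.1.sbr_left (by simp) hx hw, e2.2.sbr_left (by simp) hx hw⟩
  have hz : ∀ b : A⟦X⟧⟦X⟧⟦X⟧, varDiff A⟦X⟧ • b = 0 → b = 0 := fun b hb =>
    varDiff_add_smul_eq_zero 0 (by rwa [zero_smul, add_zero])
  have hp : ∀ b : A⟦X⟧⟦X⟧⟦X⟧, (varDiff A⟦X⟧ + varMul A⟦X⟧) • b = 0 → b = 0 := fun b hb =>
    varDiff_add_smul_eq_zero 1 (by rwa [one_smul])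
  have hm : ∀ b : A⟦X⟧⟦X⟧⟦X⟧, (varDiff A⟦X⟧ - varMul A⟦X⟧) • b = 0 → b = 0 := fun b hb =>
    varDiff_add_smul_eq_zero (-1) (by rwa [neg_smul, one_smul, ← sub_eq_add_neg])
  have hp' : ∀ (b : A⟦X⟧⟦X⟧) (H : A⟦X⟧⟦X⟧⟦X⟧), (varDiff A⟦X⟧ + varMul A⟦X⟧) • H =
      (varMul A⟦X⟧ * varMul A⟦X⟧) • C b → b = 0 := fun b H hb =>
    varDiff_add_smul_eq 1 (by rwa [one_smul])
  have hm' : ∀ (b : A⟦X⟧⟦X⟧) (H : A⟦X⟧⟦X⟧⟦X⟧), (varDiff A⟦X⟧ - varMul A⟦X⟧) • H =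
      (varMul A⟦X⟧ * varMul A⟦X⟧) • C b → b = 0 := fun b H hb =>
    varDiff_add_smul_eq (-1) (by rwa [neg_smul, one_smul, ← sub_eq_add_neg])
  have h2₂ : ∀ b : A⟦X⟧⟦X⟧, b + b = 0 → b = 0 :=
    add_self_eq_zero_powerSeries (add_self_eq_zero_powerSeries h2)
  have hrow : ∀ r, (fun k => map (C : A →+* A⟦X⟧) (T' (g₃ r) (g₃ k))) =
      (d.map (map C) : Matrix κ κ A⟦X⟧⟦X⟧) r := fun r => funext fun k => by
    rw [hTd, Matrix.map_apply]
  have key := sbr_strip_add_eq_zero hz hp hm hp' hm' (add_self_eq_zero_powerSeries h2₂) h2₂ hdm hQP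
    (hYm a ha) (hx a ha) (fun r => hrow r ▸ hx _ (hg r))
    (fun r => hrow r ▸ hT.biRowRel hr hl (fun k => p (g₃ k)) (fun _ => rfl) a (g₃ r))
    (fun r r' => hrow r ▸ hrow r' ▸
      hT.biRowRel hr hl (fun k => p (g₃ k)) (fun _ => rfl) (g₃ r) (g₃ r')) k l
  have e1 : p (g₁ i) + p h + p h + p (g₃ k) = p (g₁ i) + p (g₃ k) := by
    generalize p h = a; generalize p (g₁ i) = b; generalize p (g₃ k) = c; revert a b c; decide
  rw [e1]
  rcases sig_eq_one_or_neg_one (Subring.center A⟦X⟧⟦X⟧) (p h) with e2 | e2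
  · rw [e2, one_smul]
    exact key
  · rw [e2, neg_smul, one_smul, map_neg, map_neg, ← neg_eq_zero, ← key]
    simp only [sbr, mul_neg, neg_mul, smul_neg]
    abel

lemma coeff_sbr_C_map_C {K : Type*} [CommRing K] [Algebra K A⟦X⟧⟦X⟧] (a b : ZMod 2) (x y : A⟦X⟧)
    (r s : ℕ) : coeff r (coeff s (sbr K a b (C x) (map C y : A⟦X⟧⟦X⟧))) =
      sbr ℤ a b (coeff r x) (coeff s y) := by
  simp only [sbr, map_sub, map_sig_smul (K' := ℤ), coeff_C_mul_map_C, coeff_map_C_mul_C]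

lemma coeff_sbr_C_map_map {K : Type*} [CommRing K] [Algebra K A⟦X⟧⟦X⟧⟦X⟧] (a b : ZMod 2)
    (w : A⟦X⟧⟦X⟧) (y : A⟦X⟧) (r s m : ℕ) :
    coeff r (coeff s (coeff m (sbr K a b (C w) (map C (map C y) : A⟦X⟧⟦X⟧⟦X⟧)))) =
      sbr ℤ a b (coeff r (coeff s w)) (coeff m y) := by
  simp only [sbr, map_sub, map_sig_smul (K' := ℤ), coeff_C_mul, coeff_mul_C, coeff_map]

lemma coeff_sbr_map_C_map {K : Type*} [CommRing K] [Algebra K A⟦X⟧⟦X⟧⟦X⟧] (a b : ZMod 2)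
    (w : A⟦X⟧⟦X⟧) (y : A⟦X⟧) (r s m : ℕ) :
    coeff r (coeff s (coeff m (sbr K a b (map C w) (C (map C y) : A⟦X⟧⟦X⟧⟦X⟧)))) =
      sbr ℤ a b (coeff r (coeff m w)) (coeff s y) := by
  simp only [sbr, map_sub, map_sig_smul (K' := ℤ), coeff_C_mul, coeff_mul_C, coeff_map]

omit [DecidableEq ι] in
lemma mul_mul_eq_zero_of_strict {R : Type*} [Ring R] {N : Matrix ι ι R} (ht : ι → ℕ)
    (hlt : ∀ x, ht x < 3) (hN : ∀ x y, ht y ≤ ht x → N x y = 0) : N * N * N = 0 := by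
  ext x y
  rw [Matrix.mul_apply]
  refine Finset.sum_eq_zero fun z _ => ?_
  rw [Matrix.mul_apply, Finset.sum_mul]
  refine Finset.sum_eq_zero fun w _ => ?_
  by_cases h₁ : ht w ≤ ht x
  · simp [hN x w h₁]
  by_cases h₂ : ht z ≤ ht w
  · simp [hN w z h₂]
  · have := hlt y
    simp [hN z y (by omega)]

lemma exists_inverse_of_strict {R : Type*} [Ring R] {M : Matrix ι ι R} (ht : ι → ℕ)
    (hlt : ∀ x, ht x < 3) (hM : ∀ x y, ht y ≤ ht x → M x y = (1 : Matrix ι ι R) x y) :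
    ∃ M' : Matrix ι ι R, M * M' = 1 ∧ M' * M = 1 ∧
      ∀ x y, ht y ≤ ht x + 1 → M' x y = 2 * (1 : Matrix ι ι R) x y - M x y := by
  have hN : ∀ x y, ht y ≤ ht x → (M - 1) x y = 0 := fun x y h => by
    rw [Matrix.sub_apply, hM x y h, sub_self]
  have h3 := mul_mul_eq_zero_of_strict ht hlt hN
  have hM1 : M = 1 + (M - 1) := by abel
  refine ⟨1 - (M - 1) + (M - 1) * (M - 1), ?_, ?_, fun x y h => ?_⟩
  · conv_lhs => rw [hM1]
    linear_combination (norm := noncomm_ring) h3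
  · conv_lhs => rw [hM1]
    linear_combination (norm := noncomm_ring) h3
  · have h0 : ((M - 1) * (M - 1)) x y = 0 := by
      rw [Matrix.mul_apply]
      refine Finset.sum_eq_zero fun z _ => ?_
      by_cases h₁ : ht z ≤ ht x
      · rw [hN x z h₁, zero_mul]
      · rw [hN z y (by omega), mul_zero]
    rw [Matrix.add_apply, h0, Matrix.sub_apply, Matrix.sub_apply]
    noncomm_ring

end Main

section Gauss

open PowerSeries

variable [Ring A] {α : Fin 3 → Type*} [∀ a, Fintype (α a)] [∀ a, DecidableEq (α a)]
variable {p : (Σ a, α a) → ZMod 2}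

/-- The Serre-type relation for the blocks of the upper unitriangular factor in a `3 × 3` block
Gauss decomposition of a matrix satisfying the RTT relation. -/
lemma SeriesRTT.sbr_sbr_gauss (h2 : ∀ b : A, b + b = 0 → b = 0)
    {T F E : Matrix (Σ a, α a) (Σ a, α a) A⟦X⟧} {D D' : ∀ a, Matrix (α a) (α a) A⟦X⟧}
    (hT : SeriesRTT p T) (hTF : T = F * (Matrix.blockDiagonal' D * E))
    (hD : ∀ a, D a * D' a = 1) (hD' : ∀ a, D' a * D a = 1)
    (hF : ∀ x y, x.1 ≤ y.1 → F x y = (1 : Matrix (Σ a, α a) (Σ a, α a) A⟦X⟧) x y)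
    (hE : ∀ x y, y.1 ≤ x.1 → E x y = (1 : Matrix (Σ a, α a) (Σ a, α a) A⟦X⟧) x y)
    (i : α 0) (j h f : α 1) (k g : α 2) (r s m : ℕ) :
    sbr ℤ (p ⟨0, i⟩ + p ⟨1, j⟩ + p ⟨1, h⟩ + p ⟨2, k⟩) (p ⟨1, f⟩ + p ⟨2, g⟩)
        (sbr ℤ (p ⟨0, i⟩ + p ⟨1, j⟩) (p ⟨1, h⟩ + p ⟨2, k⟩) (coeff r (E ⟨0, i⟩ ⟨1, j⟩))
          (coeff s (E ⟨1, h⟩ ⟨2, k⟩)))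
        (coeff m (E ⟨1, f⟩ ⟨2, g⟩)) +
      sbr ℤ (p ⟨0, i⟩ + p ⟨1, j⟩ + p ⟨1, h⟩ + p ⟨2, k⟩) (p ⟨1, f⟩ + p ⟨2, g⟩)
        (sbr ℤ (p ⟨0, i⟩ + p ⟨1, j⟩) (p ⟨1, h⟩ + p ⟨2, k⟩) (coeff r (E ⟨0, i⟩ ⟨1, j⟩))
          (coeff m (E ⟨1, h⟩ ⟨2, k⟩)))
        (coeff s (E ⟨1, f⟩ ⟨2, g⟩)) = 0 := by
  obtain ⟨E', hEE, hEE', hE'⟩ := exists_inverse_of_strict (M := E) (fun x => x.1)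
    (fun x => x.1.2) (fun x y hxy => hE x y hxy)
  obtain ⟨F', hFF, hFF', hF'⟩ := exists_inverse_of_strict (M := F) (fun x => x.1.rev)
    (fun x => x.1.rev.2) (fun x y hxy => hF x y (Fin.rev_le_rev.mp hxy))
  have hB : Matrix.blockDiagonal' D * Matrix.blockDiagonal' D' = 1 := by
    simp only [← Matrix.blockDiagonal'_mul, hD]
    exact Matrix.blockDiagonal'_one
  have hB' : Matrix.blockDiagonal' D' * Matrix.blockDiagonal' D = 1 := by
    simp only [← Matrix.blockDiagonal'_mul, hD']
    exact Matrix.blockDiagonal'_one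
  set T' := E' * Matrix.blockDiagonal' D' * F' with hT'
  have hr : T * T' = 1 := by
    calc _ = F * (Matrix.blockDiagonal' D * (E * E') * Matrix.blockDiagonal' D') * F' := by
          rw [hTF, hT']; noncomm_ring
      _ = 1 := by rw [hEE, mul_one, hB, mul_one, hFF]
  have hl : T' * T = 1 := by
    calc _ = E' * (Matrix.blockDiagonal' D' * (F' * F) * Matrix.blockDiagonal' D) * E := by
          rw [hTF, hT']; noncomm_ring
      _ = 1 := by rw [hFF', mul_one, hB', mul_one, hEE']
  have hT₀ : ∀ i y, T ⟨0, i⟩ y = ∑ q, D 0 i q * E ⟨0, q⟩ y := by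
    intro i y
    rw [hTF, Matrix.mul_apply, Finset.sum_eq_single ⟨0, i⟩, hF _ _ le_rfl, Matrix.one_apply_eq,
      one_mul, Matrix.mul_apply, Fintype.sum_sigma, Fin.sum_univ_three]
    · simp [Matrix.blockDiagonal'_apply]
    · intro z _ hz
      rw [hF _ _ (Fin.zero_le _), Matrix.one_apply_ne (Ne.symm hz), zero_mul]
    · simp
  have hT₂ : ∀ x k, T' x ⟨2, k⟩ = ∑ q, E' x ⟨2, q⟩ * D' 2 q k := by
    intro x k
    have h0 : ∀ z, F' z ⟨2, k⟩ = (1 : Matrix (Σ a, α a) (Σ a, α a) A⟦X⟧) z ⟨2, k⟩ := fun z => by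
      rw [hF' _ _ (by simp), hF _ _ (Fin.le_last _), two_mul, add_sub_cancel_right]
    rw [hT', Matrix.mul_apply, Finset.sum_eq_single ⟨2, k⟩, h0, Matrix.one_apply_eq,
      mul_one, Matrix.mul_apply, Fintype.sum_sigma, Fin.sum_univ_three]
    · simp [Matrix.blockDiagonal'_apply]
    · intro z _ hz
      rw [h0, Matrix.one_apply_ne hz, mul_zero]
    · simp
  have hE₂ : ∀ q r, E' ⟨2, q⟩ ⟨2, r⟩ = if q = r then 1 else 0 := fun q r => by
    rw [hE' _ _ (by simp), hE ⟨2, q⟩ ⟨2, r⟩ le_rfl]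
    split_ifs with hqr
    · subst hqr; rw [Matrix.one_apply_eq, two_mul, add_sub_cancel_right]
    · rw [Matrix.one_apply_ne (by simpa using hqr), mul_zero, sub_zero]
  have hE₁ : ∀ h k, E' ⟨1, h⟩ ⟨2, k⟩ = -E ⟨1, h⟩ ⟨2, k⟩ := fun h k => by
    rw [hE' _ _ (by simp), Matrix.one_apply_ne (by simp), mul_zero, zero_sub]
  have hT₀₀ : ∀ i q, T ⟨0, i⟩ ⟨0, q⟩ = D 0 i q := fun i q => by
    rw [hT₀, Finset.sum_eq_single q]
    · rw [hE ⟨0, q⟩ ⟨0, q⟩ le_rfl, Matrix.one_apply_eq, mul_one]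
    · intro b _ hb
      rw [hE ⟨0, b⟩ ⟨0, q⟩ le_rfl, Matrix.one_apply_ne (by simpa using hb), mul_zero]
    · simp
  have hr₀ : ∀ a : Fin 3, a ≠ 0 → ∀ x : α a,
      (⟨a, x⟩ : Σ a, α a) ∉ Set.range (fun i : α 0 => (⟨0, i⟩ : Σ a, α a)) := by
    rintro a ha x ⟨y, hy⟩
    exact ha (congrArg Sigma.fst hy).symm
  have key := hT.sbr_sbr_add_eq_zero h2 hr hl (g₁ := fun i : α 0 => ⟨0, i⟩) (D₁ := D' 0)
    (e := fun i y => E ⟨0, i⟩ y) (g₃ := fun k : α 2 => ⟨2, k⟩) (d := D' 2) (D := D 2)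
    (Y := fun x r => E' x ⟨2, r⟩)
    (fun i r => by simp only [hT₀₀, ← Matrix.mul_apply, hD', Matrix.one_apply])
    (fun y _ i => by simp only [hT₀₀, hT₀]) (fun k => hr₀ 2 (by decide) k) (hD' 2) (hD 2)
    (fun r k => by simp only [hT₂, hE₂]; simp) (fun a _ k => hT₂ a k)
    (fun a _ => by
      by_cases ha : a.1 = 1
      · exact ⟨⟨2, k⟩, hr₀ 2 (by decide) k, fun hh => by simp [← hh] at ha⟩
      · exact ⟨⟨1, j⟩, hr₀ 1 (by decide) j, fun hh => by simp [← hh] at ha⟩)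
    i (hr₀ 1 (by decide) j) (hr₀ 1 (by decide) h) (hr₀ 1 (by decide) f) (fun r => by simp) k g rfl
  have := congrArg (fun z => coeff r (coeff s (coeff m z))) key
  simp only [map_add, coeff_sbr_C_map_map, coeff_sbr_map_C_map, map_zero] at this
  rw [← this]
  simp only [coeff_sbr_C_map_C]
  simp only [sbr, hE₁, map_neg, mul_neg, neg_mul, mul_sub, sub_mul, smul_neg]
  module

end Gauss

section RTT

open PowerSeries

variable [Ring A]

lemma coeff_mk_mul_mk (f g : ℕ → A) (r : ℕ) : coeff r (PowerSeries.mk f * PowerSeries.mk g) =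
    ∑ e ∈ Finset.range (r + 1), f e * g (r - e) := by
  rw [coeff_mul, Finset.Nat.sum_antidiagonal_eq_sum_range_succ_mk]
  simp

lemma coeff_mk_mul_mk_mul_mk (f g h : ℕ → A) (r : ℕ) :
    coeff r (PowerSeries.mk f * (PowerSeries.mk g * PowerSeries.mk h)) =
    ∑ e₁ ∈ Finset.range (r + 1), ∑ e₂ ∈ Finset.range (r + 1 - e₁),
      f e₁ * g e₂ * h (r - e₁ - e₂) := by
  rw [coeff_mul, Finset.Nat.sum_antidiagonal_eq_sum_range_succ_mk]
  refine Finset.sum_congr rfl fun e he => ?_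
  rw [coeff_mk_mul_mk, coeff_mk, Finset.mul_sum,
    Nat.sub_add_comm (Nat.lt_succ_iff.mp (Finset.mem_range.mp he))]
  simp only [mul_assoc]

lemma of_mk_mul_of_mk_eq_one {n : ℕ} {M M' : ℕ → ℕ → ℕ → A}
    (h : ∀ i j r, i < n → j < n → ∑ q ∈ Finset.range n, ∑ e ∈ Finset.range (r + 1),
      M i q e * M' q j (r - e) = if i = j ∧ r = 0 then 1 else 0) :
    (Matrix.of fun i j : Fin n => PowerSeries.mk (M i j)) *
      (Matrix.of fun i j : Fin n => PowerSeries.mk (M' i j)) = 1 := by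
  ext i j r
  have h := h i j r i.2 j.2
  rw [Finset.sum_range] at h
  simp only [Matrix.mul_apply, Matrix.of_apply, map_sum, coeff_mk_mul_mk, h, Matrix.one_apply,
    Fin.ext_iff]
  split_ifs <;> simp_all [coeff_one]

variable [Algebra ℂ A]

lemma sgn_smul (x : ZMod 2) (b : A) : sgn x • b = sig ℤ x • b :=
  map_sig_smul (K := ℂ) (K' := ℤ) (AddMonoidHom.id A) x b

lemma scomm_sgn (a b : ZMod 2) (x y : A) : scomm (sgn (a * b)) x y = sbr ℤ a b x y := by
  rw [scomm, sgn_smul, sbr]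

variable {d : ℕ} {p : ℕ → ZMod 2}

lemma RTT.seriesRTT (S : RTT A d p) {ι : Type*} {φ : ι → ℕ} (hφ : ∀ x, φ x < d) :
    SeriesRTT (fun x => p (φ x)) (Matrix.of fun x y => PowerSeries.mk (S.t (φ x) (φ y))) := by
  intro i j h k
  have hS := fun r s => S.rtt (φ i) (φ j) (φ h) (φ k) r s (hφ i) (hφ j) (hφ h) (hφ k)
  simp only [scomm_sgn, sgn_smul] at hS
  refine X_sub_mul_sbr (fun s => ?_) (fun r => ?_) (fun r s => ?_)
  · simpa using hS 0 s
  · simpa using hS r 0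
  · simp only [Matrix.of_apply, coeff_mk, hS, ← smul_sub]
    congr 1
    have e₁ : r + 1 + s - 1 = r + s := by omega
    have e₂ : r + (s + 1) - 1 = r + s := by omega
    rw [e₁, e₂]
    rcases lt_trichotomy r s with hrs | rfl | hrs
    · rw [min_eq_left (by omega), min_eq_left (by omega), Finset.sum_range_succ,
        add_sub_cancel_left, Nat.add_sub_cancel_left]
    · rw [min_eq_right (by omega), min_eq_left (by omega), sub_self, sub_self]
    · rw [min_eq_right (by omega), min_eq_right (by omega), Finset.sum_range_succ,
        Nat.add_sub_cancel]
      abel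

lemma off_add_lt {μ : ℕ → ℕ} {a n i : ℕ} (ha : a < n) (hi : i < μ a) : off μ a + i < off μ n := by
  have h := Finset.sum_le_sum_of_subset (f := μ) (Finset.range_mono (Nat.succ_le_of_lt ha))
  rw [Finset.sum_range_succ] at h
  unfold off
  omega

variable {T : ℕ → ℕ → ℕ → A} {μ : ℕ → ℕ}

lemma Gauss.F_eq_one (G : Gauss T 3 μ) (x y : Σ a : Fin 3, Fin (μ a)) (hxy : x.1 ≤ y.1) :
    (Matrix.of fun x y : Σ a : Fin 3, Fin (μ a) =>
      PowerSeries.mk (G.F x.1 y.1 x.2 y.2)) x y = (1 : Matrix _ _ A⟦X⟧) x y := by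
  obtain ⟨a, i⟩ := x
  obtain ⟨b, j⟩ := y
  ext n
  rcases hxy.lt_or_eq with h | rfl
  · have h : a < b := h
    rw [Matrix.one_apply_ne (by simp [h.ne])]
    simp [G.F_high a b _ _ _ h]
  · simp only [Matrix.of_apply, coeff_mk, G.F_diag, Matrix.one_apply, Sigma.mk.injEq, heq_eq_eq,
      true_and, Fin.ext_iff]
    split_ifs <;> simp_all [coeff_one]

lemma Gauss.E_eq_one (G : Gauss T 3 μ) (x y : Σ a : Fin 3, Fin (μ a)) (hyx : y.1 ≤ x.1) :
    (Matrix.of fun x y : Σ a : Fin 3, Fin (μ a) =>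
      PowerSeries.mk (G.E x.1 y.1 x.2 y.2)) x y = (1 : Matrix _ _ A⟦X⟧) x y := by
  obtain ⟨a, i⟩ := x
  obtain ⟨b, j⟩ := y
  ext n
  rcases hyx.lt_or_eq with h | rfl
  · have h : b < a := h
    rw [Matrix.one_apply_ne (by simp [h.ne'])]
    simp [G.E_low a b _ _ _ h]
  · simp only [Matrix.of_apply, coeff_mk, G.E_diag, Matrix.one_apply, Sigma.mk.injEq, heq_eq_eq,
      true_and, Fin.ext_iff]
    split_ifs <;> simp_all [coeff_one]

lemma Gauss.eq_mul_blockDiagonal_mul (G : Gauss T 3 μ) :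
    (Matrix.of fun x y : Σ a : Fin 3, Fin (μ a) =>
        PowerSeries.mk (T (off μ x.1 + x.2) (off μ y.1 + y.2))) =
      (Matrix.of fun x y : Σ a : Fin 3, Fin (μ a) => PowerSeries.mk (G.F x.1 y.1 x.2 y.2)) *
      (Matrix.blockDiagonal'
          (m' := fun a : Fin 3 => Fin (μ a)) (n' := fun a : Fin 3 => Fin (μ a))
          (fun a => Matrix.of fun i j => PowerSeries.mk (G.D a i j)) *
        Matrix.of fun x y : Σ a : Fin 3, Fin (μ a) =>
          PowerSeries.mk (G.E x.1 y.1 x.2 y.2)) := by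
  ext ⟨a, i⟩ ⟨b, j⟩ r
  have hDE : ∀ (c : Fin 3) (q : Fin (μ c)), (Matrix.blockDiagonal'
      (m' := fun a : Fin 3 => Fin (μ a)) (n' := fun a : Fin 3 => Fin (μ a))
      (fun a => Matrix.of fun i j => PowerSeries.mk (G.D a i j)) * Matrix.of fun x y :
        Σ a : Fin 3, Fin (μ a) => PowerSeries.mk (G.E x.1 y.1 x.2 y.2)) ⟨c, q⟩ ⟨b, j⟩ =
      ∑ q' : Fin (μ c), PowerSeries.mk (G.D c q q') * PowerSeries.mk (G.E c b q' j) := by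
    intro c q
    rw [Matrix.mul_apply, Fintype.sum_sigma, Finset.sum_eq_single c]
    · simp [Matrix.blockDiagonal'_apply]
    · intro z _ hz
      simp [Matrix.blockDiagonal'_apply, hz.symm]
    · simp
  rw [Matrix.mul_apply, Fintype.sum_sigma]
  simp only [hDE, Finset.mul_sum, Matrix.of_apply, map_sum, coeff_mk_mul_mk_mul_mk, coeff_mk]
  rw [G.decomp a b i j r a.2 b.2 i.2 j.2]
  simp only [Finset.sum_range]

end RTT

/-- For `μ = (μ 0, μ 1, μ 2)`, one has
`[[E_{1;i,j}(u), E_{2;h,k}(v)], E_{2;f,g}(w)] + [[E_{1;i,j}(u), E_{2;h,k}(w)], E_{2;f,g}(v)] = 0`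
in `Y[[u^{-1}, v^{-1}, w^{-1}]]`, stated as the vanishing of the coefficient of
`u^{-r} v^{-s} w^{-m}` for all `r, s, m ≥ 0`. -/
theorem statement12 [Ring A] [Algebra ℂ A] {d : ℕ} {p : ℕ → ZMod 2} {μ : ℕ → ℕ}
    (S : RTT A d p) (G : Gauss S.t 3 μ) (hd : off μ 3 = d) :
    ∀ i j h k f g r s m : ℕ,
      i < μ 0 → j < μ 1 → h < μ 1 → k < μ 2 → f < μ 1 → g < μ 2 →
      scomm
          (sgn ((p i + p (μ 0 + j) + p (μ 0 + h) + p (μ 0 + μ 1 + k)) *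
            (p (μ 0 + f) + p (μ 0 + μ 1 + g))))
          (scomm (sgn ((p i + p (μ 0 + j)) * (p (μ 0 + h) + p (μ 0 + μ 1 + k))))
            (G.E 0 1 i j r) (G.E 1 2 h k s))
          (G.E 1 2 f g m) +
        scomm
          (sgn ((p i + p (μ 0 + j) + p (μ 0 + h) + p (μ 0 + μ 1 + k)) *
            (p (μ 0 + f) + p (μ 0 + μ 1 + g))))
          (scomm (sgn ((p i + p (μ 0 + j)) * (p (μ 0 + h) + p (μ 0 + μ 1 + k))))
            (G.E 0 1 i j r) (G.E 1 2 h k m))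
          (G.E 1 2 f g s) = 0 := by
  intro i j h k f g r s m hi hj hh hk hf hg
  subst hd
  have h2 : ∀ b : A, b + b = 0 → b = 0 := fun b hb => by
    rw [← two_smul ℂ] at hb
    exact (smul_eq_zero_iff_right two_ne_zero).mp hb
  have key := (S.seriesRTT (φ := fun x : Σ a : Fin 3, Fin (μ a) => off μ x.1 + x.2)
    (fun x => off_add_lt x.1.2 x.2.2)).sbr_sbr_gauss h2 G.eq_mul_blockDiagonal_mul
    (fun a => of_mk_mul_of_mk_eq_one fun i j r => G.D_inv a i j r a.2)
    (fun a => of_mk_mul_of_mk_eq_one fun i j r => G.D_inv' a i j r a.2)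
    G.F_eq_one G.E_eq_one ⟨i, hi⟩ ⟨j, hj⟩ ⟨h, hh⟩ ⟨f, hf⟩ ⟨k, hk⟩ ⟨g, hg⟩ r s m
  simpa [scomm_sgn, off, Finset.sum_range_succ] using key

end SuperYangian
end
end

section
/- For a composition μ = (μ_1,...,μ_n) of M+N with n ≥ 4, the super Serre relation [[E_{a;i,f_1}^{(r)}, E_{a+1;f_2,j}^{(1)}], [E_{a+1;h,g_1}^{(1)}, E_{a+2;g_2,k}^{(s)}]] = 0 holds in Y_μ for all 1 ≤ a ≤ n-3, all r,s ≥ 1, and all admissible indices i, f_1, f_2, j, h, g_1, g_2, k. -/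
noncomputable section

namespace SuperYangian

variable {A : Type*}

open PowerSeries

theorem zmod_two_cases (x : ZMod 2) : x = 0 ∨ x = 1 := by
  revert x
  decide

theorem sgn_add (x y : ZMod 2) : sgn (x + y) = sgn x * sgn y := by
  rcases zmod_two_cases x with rfl | rfl <;> rcases zmod_two_cases y with rfl | rfl <;>
    simp [sgn, show (1 : ZMod 2) + 1 = 0 from rfl]

theorem sgn_mul_self (x : ZMod 2) : sgn x * sgn x = 1 := by
  rcases zmod_two_cases x with rfl | rfl <;> simp [sgn]

section RingIdentities

variable {R : Type*} [Ring R]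

/-- If `W` is block lower and `E` is block upper with respect to the idempotent `P`, then the
compression of `W * E` by `P` factors. -/
theorem compression_mul {P W E : R} (hP : P * P = P) (hW : P * W = P * W * P) :
    P * (W * E) * P + 1 - P = (P * W * P + 1 - P) * (P * E * P + 1 - P) := by
  have h1 : P * (W * E) * P = P * W * P * E * P := by
    rw [← mul_assoc P W E, ← hW]
  have h2 : (P * W * P + 1 - P) * (P * E * P + 1 - P) =
      P * W * (P * P) * E * P + P * W * P - P * W * (P * P) + P * E * P - (P * P) * E * P
        + 1 - P - P + P * P := by noncomm_ring
  rw [h1, h2, hP]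
  noncomm_ring

/-- Rows of the upper factor `E` are recovered from the rows of `W * E`. -/
theorem row_of_upper_factor {P Q W E : R} (hP : P * P = P) (hW : P * W = P * W * P)
    (hQP : Q * P = Q) (hQ : Q * E * P = Q)
    (hWu : IsUnit (P * W * P + 1 - P)) (hEu : IsUnit (P * E * P + 1 - P)) :
    ∃ u : Rˣ, (u : R) = P * (W * E) * P + 1 - P ∧ Q * E = Q * ↑u⁻¹ * (P * (W * E)) := by
  obtain ⟨w, hw⟩ := hWu
  obtain ⟨e, he⟩ := hEu
  refine ⟨w * e, by rw [Units.val_mul, hw, he, compression_mul hP hW], ?_⟩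
  have hQe : Q * (e : R) = Q := by
    rw [he, mul_sub, mul_add, ← mul_assoc, ← mul_assoc, hQP, hQ, mul_one, add_sub_cancel_right]
  have hQe' : Q * (↑e⁻¹ : R) = Q := by
    conv_lhs => rw [← hQe]
    rw [mul_assoc, Units.mul_inv, mul_one]
  have hwP : P * (W * E) = w * (P * E) := by
    have : (P * W * P + 1 - P) * (P * E) = P * W * (P * P) * E + P * E - P * P * E := by
      noncomm_ring
    rw [hw, this, hP, ← hW]
    noncomm_ring
  rw [hwP, mul_inv_rev, Units.val_mul, ← mul_assoc Q, hQe', mul_assoc Q, ← mul_assoc _ (w : R),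
    Units.inv_mul, one_mul, ← mul_assoc, hQP]

/-- Columns of the left factor `E` are recovered from the columns of `E * V`. -/
theorem column_of_left_factor {K E V : R} (hK : K * K = K) (hV : V * K = K * V * K)
    (hE : K * E = K) {u : Rˣ} (hu : (u : R) = K * (E * V) * K + 1 - K) :
    E * K = E * V * K * ↑u⁻¹ := by
  have h1 : K * (E * V) * K = K * V * K := by rw [← mul_assoc K E V, hE]
  rw [Units.eq_mul_inv_iff_mul_eq, hu, h1]
  have : E * K * (K * V * K + 1 - K) = E * (K * K) * V * K + E * K - E * (K * K) := by
    noncomm_ring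
  rw [this, hK, mul_assoc E V K, hV]
  noncomm_ring

/-- The columns `K` of the inverse of `F * D`, when `F` is trivial in those columns. -/
theorem column_of_inverse {K F D V : R} (hK : K * K = K) (hF : F * K = K) (hD : D * K = K * D)
    (hDu : IsUnit D) (hV : V * (F * D) = 1) : V * K = K * V * K := by
  obtain ⟨d, rfl⟩ := hDu
  have h1 : V * K * d = K := by
    have : F * (d * K) = K * d := by rw [hD, ← mul_assoc, hF]
    rw [mul_assoc, ← this, ← mul_assoc F, ← mul_assoc, hV, one_mul]
  have h2 : V * K = K * ↑d⁻¹ := by rw [Units.eq_mul_inv_iff_mul_eq, h1]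
  rw [mul_assoc, h2, ← mul_assoc, hK]

end RingIdentities

section MatrixSeries

variable {ι : Type*} [Fintype ι] [DecidableEq ι] [Ring A]

/-- The constant diagonal idempotent selecting the indices satisfying `s`. -/
def proj (A : Type*) [Ring A] (s : ι → Prop) [DecidablePred s] : PowerSeries (Matrix ι ι A) :=
  C (Matrix.diagonal fun x => if s x then 1 else 0)

variable (s t : ι → Prop) [DecidablePred s] [DecidablePred t]

@[simp]
theorem coeff_proj_mul (n : ℕ) (f : PowerSeries (Matrix ι ι A)) (x y : ι) :
    coeff n (proj A s * f) x y = if s x then coeff n f x y else 0 := by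
  simp [proj, Matrix.diagonal_mul]

@[simp]
theorem coeff_mul_proj (n : ℕ) (f : PowerSeries (Matrix ι ι A)) (x y : ι) :
    coeff n (f * proj A s) x y = if s y then coeff n f x y else 0 := by
  simp [proj, Matrix.mul_diagonal]

theorem series_ext {f g : PowerSeries (Matrix ι ι A)}
    (h : ∀ n x y, coeff n f x y = coeff n g x y) : f = g := by
  ext n x y
  exact h n x y

theorem series_congr {f g : PowerSeries (Matrix ι ι A)} (h : f = g) (n : ℕ) (x y : ι) :
    coeff n f x y = coeff n g x y := by
  rw [h]

theorem proj_mul_proj_of_imp (h : ∀ x, s x → t x) : proj A s * proj A t = proj A s := by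
  rw [proj, proj, ← map_mul, Matrix.diagonal_mul_diagonal]
  congr 2
  ext x
  by_cases hs : s x <;> simp [hs, h]

theorem proj_mul_self : proj A s * proj A s = proj A s :=
  proj_mul_proj_of_imp s s fun _ => id

theorem proj_mul_eq_compression {f : PowerSeries (Matrix ι ι A)}
    (h : ∀ n x y, s x → ¬ t y → coeff n f x y = 0) :
    proj A s * f = proj A s * f * proj A t := by
  apply series_ext
  intro n x y
  rw [coeff_mul_proj, coeff_proj_mul]
  split_ifs with hs ht <;> first | rfl | exact h n x y hs ht

theorem mul_proj_eq_compression {f : PowerSeries (Matrix ι ι A)}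
    (h : ∀ n x y, ¬ s x → t y → coeff n f x y = 0) :
    f * proj A t = proj A s * f * proj A t := by
  apply series_ext
  intro n x y
  rw [coeff_mul_proj, coeff_mul_proj, coeff_proj_mul]
  split_ifs with ht hs <;> first | rfl | exact h n x y hs ht

theorem compression_congr {f g : PowerSeries (Matrix ι ι A)}
    (h : ∀ n x y, s x → t y → coeff n f x y = coeff n g x y) :
    proj A s * f * proj A t = proj A s * g * proj A t := by
  apply series_ext
  intro n x y
  rw [coeff_mul_proj, coeff_mul_proj, coeff_proj_mul, coeff_proj_mul]
  split_ifs with ht hs <;> first | rfl | exact h n x y hs ht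

theorem coeff_one_of_ne {x y : ι} (h : x ≠ y) (n : ℕ) :
    coeff n (1 : PowerSeries (Matrix ι ι A)) x y = 0 := by
  rw [coeff_one]
  split_ifs <;> simp [h]

theorem isUnit_of_constantCoeff_eq_one {f : PowerSeries (Matrix ι ι A)}
    (h : constantCoeff f = 1) : IsUnit f :=
  isUnit_iff_constantCoeff.2 (h ▸ isUnit_one)

theorem isUnit_compression {f : PowerSeries (Matrix ι ι A)} (h : constantCoeff f = 1) :
    IsUnit (proj A s * f * proj A s + 1 - proj A s) := by
  apply isUnit_of_constantCoeff_eq_one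
  have : constantCoeff (proj A s * proj A s) = constantCoeff (proj A s) := by
    rw [proj_mul_self]
  simp only [map_sub, map_add, map_mul, h, mul_one, map_one] at this ⊢
  rw [this, add_sub_cancel_left]

variable [Algebra ℂ A] (p : ι → ZMod 2)

/-- The diagonal matrix with entries `(-1)^{q * p x} z`.  Commuting with it amounts to
supercommuting with an element `z` of parity `q`. -/
def twist (q : ZMod 2) (z : A) : PowerSeries (Matrix ι ι A) :=
  C (Matrix.diagonal fun x => sgn (q * p x) • z)

@[simp]
theorem coeff_twist_mul (q : ZMod 2) (z : A) (n : ℕ) (f : PowerSeries (Matrix ι ι A)) (x y : ι) :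
    coeff n (twist p q z * f) x y = sgn (q * p x) • (z * coeff n f x y) := by
  simp [twist, Matrix.diagonal_mul]

@[simp]
theorem coeff_mul_twist (q : ZMod 2) (z : A) (n : ℕ) (f : PowerSeries (Matrix ι ι A)) (x y : ι) :
    coeff n (f * twist p q z) x y = sgn (q * p y) • (coeff n f x y * z) := by
  simp [twist, Matrix.mul_diagonal]

theorem smul_eq_smul_iff_eq_sgn (u v : ZMod 2) (b c : A) :
    sgn u • b = sgn v • c ↔ b = sgn (u + v) • c := by
  constructor
  · intro h
    rw [sgn_add, mul_smul, ← h, ← mul_smul, sgn_mul_self, one_smul]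
  · rintro rfl
    rw [sgn_add, ← mul_smul, ← mul_assoc, sgn_mul_self, one_mul]

theorem commute_twist_compression_iff (q : ZMod 2) (z : A) (f : PowerSeries (Matrix ι ι A)) :
    Commute (twist p q z) (proj A s * f * proj A t) ↔
      ∀ n x y, s x → t y →
        z * coeff n f x y = sgn (q * (p x + p y)) • (coeff n f x y * z) := by
  constructor
  · intro h n x y hx hy
    have := series_congr h.eq n x y
    simpa [hx, hy, smul_eq_smul_iff_eq_sgn, mul_add] using this
  · intro h
    apply series_ext
    intro n x y
    by_cases hx : s x <;> by_cases hy : t y <;> simp [hx, hy]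
    rw [smul_eq_smul_iff_eq_sgn, ← mul_add, h n x y hx hy]

theorem commute_twist_proj (q : ZMod 2) (z : A) : Commute (twist p q z) (proj A s) := by
  apply series_ext
  intro n x y
  rw [coeff_mul_proj, coeff_proj_mul]
  by_cases hxy : x = y
  · simp [hxy]
  · simp only [twist, coeff_C]
    split_ifs <;> simp [hxy]

/-- The constant matrix unit `c • e_{ij}`. -/
def matUnit (A : Type*) [Ring A] [Algebra ℂ A] (c : ℂ) (i j : ι) : PowerSeries (Matrix ι ι A) :=
  C (Matrix.single i j (algebraMap ℂ A c))

theorem coeff_mul_matUnit (c : ℂ) (i j : ι) (n : ℕ) (f : PowerSeries (Matrix ι ι A)) (x y : ι) :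
    coeff n (f * matUnit A c i j) x y = if y = j then c • coeff n f x i else 0 := by
  split_ifs with h
  · subst h
    simp [matUnit, Algebra.smul_def, Algebra.commutes]
  · simp [matUnit, h]

theorem coeff_matUnit_mul (c : ℂ) (i j : ι) (n : ℕ) (f : PowerSeries (Matrix ι ι A)) (x y : ι) :
    coeff n (matUnit A c i j * f) x y = if x = i then c • coeff n f j y else 0 := by
  split_ifs with h
  · subst h
    simp [matUnit, Algebra.smul_def]
  · simp [matUnit, h]

theorem coeff_sandwich_matUnit (c : ℂ) (i j : ι) (n : ℕ) (M : Matrix ι ι A)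
    (f : PowerSeries (Matrix ι ι A)) (x y : ι) :
    coeff n (C M * (matUnit A c i j * f)) x y = c • (M x i * coeff n f j y) := by
  rw [coeff_C_mul, Matrix.mul_apply]
  simp [coeff_matUnit_mul]

theorem coeff_sandwich_matUnit' (c : ℂ) (i j : ι) (n : ℕ) (M : Matrix ι ι A)
    (f : PowerSeries (Matrix ι ι A)) (x y : ι) :
    coeff n (f * (matUnit A c i j * C M)) x y = c • (coeff n f x i * M j y) := by
  rw [← mul_assoc, coeff_mul_C, Matrix.mul_apply]
  simp [coeff_mul_matUnit]

theorem proj_mul_matUnit (c : ℂ) {i : ι} (j : ι) (h : ¬ s i) :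
    proj A s * matUnit A c i j = 0 := by
  apply series_ext
  intro n x y
  rw [coeff_proj_mul, matUnit, coeff_C]
  split_ifs with hx hn
  · have hix : i ≠ x := by
      rintro rfl
      exact h hx
    simp [hix]
  · simp
  · simp

theorem matUnit_mul_proj (c : ℂ) (i : ι) {j : ι} (h : ¬ s j) :
    matUnit A c i j * proj A s = 0 := by
  apply series_ext
  intro n x y
  rw [coeff_mul_proj, matUnit, coeff_C]
  split_ifs with hy hn
  · have hjy : j ≠ y := by
      rintro rfl
      exact h hy
    simp [hjy]
  · simp
  · simp


/-- The RTT relations in the form `(u - v) [t_{ij}(u), t_{hk}(v)] = ± (…)`, for a matrix `T` of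
power series with constant term `1`. -/
structure IsRTT (p : ι → ZMod 2) (T : PowerSeries (Matrix ι ι A)) : Prop where
  const : constantCoeff T = 1
  rel : ∀ i j h k r s,
    scomm (sgn ((p i + p j) * (p h + p k))) (coeff (r + 1) T i j) (coeff s T h k) -
      scomm (sgn ((p i + p j) * (p h + p k))) (coeff r T i j) (coeff (s + 1) T h k) =
    sgn (p i * p j + p i * p h + p j * p h) •
      (coeff r T h j * coeff s T i k - coeff s T h j * coeff r T i k)

namespace IsRTT

variable {p} {T : PowerSeries (Matrix ι ι A)} (hT : IsRTT p T)
include hT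

theorem coeff_zero : coeff 0 T = 1 := by
  rw [coeff_zero_eq_constantCoeff_apply, hT.const]

theorem commute_twist_zero (i j : ι) (f : PowerSeries (Matrix ι ι A)) :
    Commute (twist p (p i + p j) (coeff 0 T i j)) f := by
  rw [hT.coeff_zero]
  by_cases hij : i = j
  · subst hij
    have : twist p (p i + p i) ((1 : Matrix ι ι A) i i) = 1 := by
      simp [twist, CharTwo.add_self_eq_zero, sgn]
    rw [this]
    exact Commute.one_left f
  · have : twist p (p i + p j) ((1 : Matrix ι ι A) i j) = 0 := by
      simp [twist, hij]
    rw [this]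
    exact Commute.zero_left f

theorem twist_commutator (i j : ι) (r : ℕ) :
    X * (twist p (p i + p j) (coeff (r + 1) T i j) * T -
        T * twist p (p i + p j) (coeff (r + 1) T i j)) -
      (twist p (p i + p j) (coeff r T i j) * T - T * twist p (p i + p j) (coeff r T i j)) =
    X * (C (coeff r T) * (matUnit A (sgn (p i * p j)) j i * T) -
      T * (matUnit A (sgn (p i * p j)) j i * C (coeff r T))) := by
  apply series_ext
  rintro (_ | s) h k
  · have h0 : coeff 0 (twist p (p i + p j) (coeff r T i j) * T) h k =
        coeff 0 (T * twist p (p i + p j) (coeff r T i j)) h k := by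
      rw [coeff_twist_mul, coeff_mul_twist, hT.coeff_zero]
      by_cases hk : h = k
      · subst hk
        rw [Matrix.one_apply_eq, mul_one, one_mul]
      · simp [hk]
    simp only [map_sub, coeff_zero_X_mul, Matrix.sub_apply, h0]
    simp
  · have key := congr_arg (sgn ((p i + p j) * p h) • ·) (hT.rel i j h k r s)
    simp only [map_sub, coeff_succ_X_mul, Matrix.sub_apply, coeff_sandwich_matUnit,
      coeff_sandwich_matUnit', coeff_twist_mul, coeff_mul_twist]
    have e1 : sgn (p i * p j + p i * p h + p j * p h) =
        sgn ((p i + p j) * p h) * sgn (p i * p j) := by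
      rw [← sgn_add]
      congr 1
      ring
    have e2 : sgn ((p i + p j) * (p h + p k)) =
        sgn ((p i + p j) * p h) * sgn ((p i + p j) * p k) := by
      rw [← sgn_add, mul_add]
    simp only [scomm, e1, e2, smul_sub, ← mul_smul, ← mul_assoc, sgn_mul_self, one_mul] at key
    simpa only [← smul_sub] using key

/-- The elements `t_{ij}^{(1)}` act on `T` by inner derivations up to a matrix unit. -/
theorem commute_twist_one (i j : ι) :
    Commute (twist p (p i + p j) (coeff 1 T i j) - matUnit A (sgn (p i * p j)) j i) T := by
  have h := hT.twist_commutator i j 0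
  rw [(hT.commute_twist_zero i j T).eq, sub_self, sub_zero, hT.coeff_zero] at h
  have := X_mul_cancel h
  rw [map_one, one_mul, mul_one, zero_add] at this
  rw [Commute, SemiconjBy, sub_mul, mul_sub, sub_eq_sub_iff_sub_eq_sub, this]

theorem twist_commutator_inv {T' : PowerSeries (Matrix ι ι A)} (h₁ : T * T' = 1) (h₂ : T' * T = 1)
    (i j : ι) (r : ℕ) :
    X * (T' * twist p (p i + p j) (coeff (r + 1) T i j) -
        twist p (p i + p j) (coeff (r + 1) T i j) * T') -
      (T' * twist p (p i + p j) (coeff r T i j) - twist p (p i + p j) (coeff r T i j) * T') =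
    X * (T' * C (coeff r T) * matUnit A (sgn (p i * p j)) j i -
      matUnit A (sgn (p i * p j)) j i * (C (coeff r T) * T')) := by
  have key := congr_arg (T' * · * T') (hT.twist_commutator i j r)
  have hX : ∀ f : PowerSeries (Matrix ι ι A), T' * (X * f) = X * (T' * f) := fun f => by
    rw [← mul_assoc, (commute_X T').eq, mul_assoc]
  have hc₁ : ∀ f, T * (T' * f) = f := fun f => by rw [← mul_assoc, h₁, one_mul]
  have hc₂ : ∀ f, T' * (T * f) = f := fun f => by rw [← mul_assoc, h₂, one_mul]
  simpa only [mul_sub, sub_mul, mul_assoc, hX, hc₁, hc₂, h₁, mul_one] using key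

/-- `t_{ij}(u)` supercommutes with the entries `(h, k)` of `T(v)⁻¹` for `h ≠ j` and `k ≠ i`. -/
theorem commute_twist_inv {T' : PowerSeries (Matrix ι ι A)} (h₁ : T * T' = 1) (h₂ : T' * T = 1)
    {i j : ι} (hs : ¬ s j) (ht : ¬ t i) (r : ℕ) :
    Commute (twist p (p i + p j) (coeff r T i j)) (proj A s * T' * proj A t) := by
  induction r with
  | zero => exact hT.commute_twist_zero i j _
  | succ r ih =>
    have key := congr_arg (proj A s * · * proj A t) (hT.twist_commutator_inv h₁ h₂ i j r)
    have hcomp : ∀ z : A, proj A s * (T' * twist p (p i + p j) z -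
        twist p (p i + p j) z * T') * proj A t =
        (proj A s * T' * proj A t) * twist p (p i + p j) z -
          twist p (p i + p j) z * (proj A s * T' * proj A t) := fun z => by
      rw [mul_sub, sub_mul, ← mul_assoc, mul_assoc _ _ (proj A t),
        (commute_twist_proj t p _ z).eq, ← mul_assoc, ← mul_assoc (proj A s),
        ← (commute_twist_proj s p _ z).eq]
      simp only [mul_assoc]
    have hX : ∀ f : PowerSeries (Matrix ι ι A),
        proj A s * (X * f) * proj A t = X * (proj A s * f * proj A t) := fun f => by
      rw [← mul_assoc, (commute_X _).eq]
      simp only [mul_assoc]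
    have hzero : proj A s * (T' * C (coeff r T) * matUnit A (sgn (p i * p j)) j i -
        matUnit A (sgn (p i * p j)) j i * (C (coeff r T) * T')) * proj A t = 0 := by
      rw [mul_sub, ← mul_assoc _ (matUnit A _ j i), proj_mul_matUnit s _ _ hs, zero_mul, sub_zero,
        mul_assoc, mul_assoc, matUnit_mul_proj t _ _ ht, mul_zero, mul_zero]
    simp only [mul_sub (proj A s) (X * _), sub_mul (_ * (X * _)), hX, hcomp, hzero, ih.eq, sub_self,
      sub_zero, mul_zero] at key
    have := X_mul_cancel (key.trans (mul_zero X).symm)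
    exact (sub_eq_zero.1 this).symm

end IsRTT

/-- A block Gauss decomposition `T = F * D * E`, the block of the index `x` being `blk x`. -/
structure IsGauss (blk : ι → ℕ) (T F D E : PowerSeries (Matrix ι ι A)) : Prop where
  eq : T = F * D * E
  const_F : constantCoeff F = 1
  const_D : constantCoeff D = 1
  const_E : constantCoeff E = 1
  lower : ∀ n x y, blk x ≤ blk y → coeff n F x y = coeff n (1 : PowerSeries (Matrix ι ι A)) x y
  upper : ∀ n x y, blk y ≤ blk x → coeff n E x y = coeff n (1 : PowerSeries (Matrix ι ι A)) x y
  diag : ∀ n x y, blk x ≠ blk y → coeff n D x y = 0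

namespace IsGauss

variable {blk : ι → ℕ} {T F D E : PowerSeries (Matrix ι ι A)}

theorem row_eq (hG : IsGauss blk T F D E) (a : ℕ) :
    ∃ u : (PowerSeries (Matrix ι ι A))ˣ,
      (u : PowerSeries (Matrix ι ι A)) =
        proj A (blk · ≤ a) * T * proj A (blk · ≤ a) + 1 - proj A (blk · ≤ a) ∧
      proj A (blk · = a) * E = proj A (blk · = a) * ↑u⁻¹ * (proj A (blk · ≤ a) * T) := by
  have hF : proj A (blk · ≤ a) * F = proj A (blk · ≤ a) * F * proj A (blk · ≤ a) :=
    proj_mul_eq_compression _ _ fun n x y hx hy => by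
      rw [hG.lower n x y (by lia), coeff_one_of_ne]
      rintro rfl
      exact hy hx
  have hD : proj A (blk · ≤ a) * D = proj A (blk · ≤ a) * D * proj A (blk · ≤ a) :=
    proj_mul_eq_compression _ _ fun n x y hx hy => hG.diag n x y (by lia)
  have hQP : proj A (blk · = a) * proj A (blk · ≤ a) = proj A (blk · = a) :=
    proj_mul_proj_of_imp _ _ fun x h => h.le
  have hQ : proj A (blk · = a) * E * proj A (blk · ≤ a) = proj A (blk · = a) := by
    rw [compression_congr (blk · = a) (blk · ≤ a) (g := 1), mul_one, hQP]
    intro n x y hx hy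
    exact hG.upper n x y (by lia)
  rw [hG.eq]
  apply row_of_upper_factor (proj_mul_self _) _ hQP hQ
  · apply isUnit_compression
    rw [map_mul, hG.const_F, hG.const_D, mul_one]
  · exact isUnit_compression _ hG.const_E
  · conv_lhs => rw [← mul_assoc, hF, mul_assoc, hD]
    conv_rhs => rw [← mul_assoc, hF]
    simp only [mul_assoc]

theorem column_eq (hG : IsGauss blk T F D E) {m : ℕ} (hm : ∀ x, blk x ≤ m)
    {T' E' : PowerSeries (Matrix ι ι A)} (hT : constantCoeff T = 1) (h₁ : T * T' = 1)
    (h₂ : T' * T = 1) (hE₁ : E * E' = 1) (hE₂ : E' * E = 1) :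
    ∃ u : (PowerSeries (Matrix ι ι A))ˣ,
      (u : PowerSeries (Matrix ι ι A)) =
        proj A (blk · = m) * T' * proj A (blk · = m) + 1 - proj A (blk · = m) ∧
      E' * proj A (blk · = m) = T' * proj A (blk · = m) * ↑u⁻¹ := by
  have hT' : constantCoeff T' = 1 := by
    simpa [hT] using congr_arg constantCoeff h₁
  obtain ⟨u, hu⟩ := isUnit_compression (blk · = m) hT'
  have hE : proj A (blk · = m) * E = proj A (blk · = m) := by
    have := compression_congr (A := A) (blk · = m) (fun _ => True) (f := E) (g := 1)
      fun n x y hx _ => hG.upper n x y (hx ▸ hm y)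
    simpa [proj] using this
  have hF : F * proj A (blk · = m) = proj A (blk · = m) := by
    have := compression_congr (A := A) (fun _ => True) (blk · = m) (f := F) (g := 1)
      fun n x y _ hy => hG.lower n x y (hy ▸ hm x)
    simpa [proj] using this
  have hD : D * proj A (blk · = m) = proj A (blk · = m) * D := by
    rw [mul_proj_eq_compression (blk · = m) (blk · = m) (f := D), ← proj_mul_eq_compression]
    · exact fun n x y hx hy => hG.diag n x y fun h => hy (h ▸ hx)
    · exact fun n x y hx hy => hG.diag n x y fun h => hx (h ▸ hy)
  have hKE : proj A (blk · = m) * E' = proj A (blk · = m) := by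
    conv_lhs => rw [← hE]
    rw [mul_assoc, hE₁, mul_one]
  have hTE : T' = E' * (E * T') := by rw [← mul_assoc, hE₂, one_mul]
  have hV : E * T' * (F * D) = 1 := by
    have : T' * (F * D) = E' := by
      rw [← mul_one (T' * (F * D)), ← hE₁, ← mul_assoc, mul_assoc T', ← hG.eq, h₂, one_mul]
    rw [mul_assoc, this, hE₁]
  refine ⟨u, hu, ?_⟩
  have hVK := column_of_inverse (proj_mul_self (A := A) (blk · = m)) hF hD
    (isUnit_of_constantCoeff_eq_one hG.const_D) hV
  have := column_of_left_factor (proj_mul_self (A := A) (blk · = m)) hVK hKE (u := u)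
    (by rw [hu, ← hTE])
  rwa [← hTE] at this

theorem commute_row (hG : IsGauss blk T F D E) {a : ℕ} {y : PowerSeries (Matrix ι ι A)}
    (hP : Commute y (proj A (blk · ≤ a))) (hQ : Commute y (proj A (blk · = a)))
    (hPT : Commute y (proj A (blk · ≤ a) * T * proj A (blk · ≤ a)))
    (hTs : Commute y (proj A (blk · ≤ a) * T * proj A s)) :
    Commute y (proj A (blk · = a) * E * proj A s) := by
  obtain ⟨u, hu, hQE⟩ := hG.row_eq a
  have hyu : Commute y u := by
    rw [hu]
    exact (hPT.add_right (Commute.one_right y)).sub_right hP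
  rw [hQE, mul_assoc]
  exact (hQ.mul_right hyu.units_inv_right).mul_right hTs

theorem commute_column (hG : IsGauss blk T F D E) {m : ℕ} (hm : ∀ x, blk x ≤ m)
    {T' E' : PowerSeries (Matrix ι ι A)} (hT : constantCoeff T = 1) (h₁ : T * T' = 1)
    (h₂ : T' * T = 1) (hE₁ : E * E' = 1) (hE₂ : E' * E = 1) {y : PowerSeries (Matrix ι ι A)}
    (hK : Commute y (proj A (blk · = m)))
    (hKT : Commute y (proj A (blk · = m) * T' * proj A (blk · = m)))
    (hsT : Commute y (proj A s * T' * proj A (blk · = m))) :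
    Commute y (proj A s * E' * proj A (blk · = m)) := by
  obtain ⟨u, hu, hEK⟩ := hG.column_eq hm hT h₁ h₂ hE₁ hE₂
  have hyu : Commute y u := by
    rw [hu]
    exact (hKT.add_right (Commute.one_right y)).sub_right hK
  rw [mul_assoc, hEK, ← mul_assoc, ← mul_assoc]
  exact hsT.mul_right hyu.units_inv_right

/-- The supercommutator of the row `a` of `E` with `t_{ij}^{(1)}`, for `i`, `j` in later blocks. -/
theorem scomm_upper_t_one (hG : IsGauss blk T F D E) (hT : IsRTT p T) {i j x y : ι}
    (hi : blk x < blk i) (hj : blk x < blk j) (n : ℕ) :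
    scomm (sgn ((p x + p y) * (p i + p j))) (coeff n E x y) (coeff 1 T i j) =
      if y = i then (sgn ((p i + p j) * p y) * sgn (p i * p j)) • coeff n E x j else 0 := by
  have hproj : ∀ (s : ι → Prop) [DecidablePred s], ¬ s i → ¬ s j → Commute
      (twist p (p i + p j) (coeff 1 T i j) - matUnit A (sgn (p i * p j)) j i) (proj A s) := by
    intro s _ hi hj
    apply (commute_twist_proj s p _ _).sub_left
    rw [Commute, SemiconjBy, proj_mul_matUnit s _ _ hj, matUnit_mul_proj s _ _ hi]
  have hy := hT.commute_twist_one i j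
  have hP := hproj (blk · ≤ blk x) (by lia) (by lia)
  have hQ := hproj (blk · = blk x) (by lia) (by lia)
  have hone : proj A (fun _ : ι => True) = 1 := by simp [proj]
  have := hG.commute_row (fun _ => True) hP hQ ((hP.mul_right hy).mul_right hP)
    ((hP.mul_right hy).mul_right (by rw [hone]; exact Commute.one_right _))
  rw [hone, mul_one, Commute, SemiconjBy] at this
  have key := series_congr this n x y
  have hxj : x ≠ j := by
    rintro rfl
    exact hj.false
  simp only [sub_mul, mul_sub, map_sub, Matrix.sub_apply, coeff_twist_mul, coeff_mul_twist,
    coeff_matUnit_mul, coeff_mul_matUnit, coeff_proj_mul, if_true, if_neg hxj, sub_zero] at key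
  have e : sgn ((p x + p y) * (p i + p j)) =
      sgn ((p i + p j) * p y) * sgn ((p i + p j) * p x) := by
    rw [← sgn_add]
    congr 1
    ring
  have key' : sgn ((p i + p j) * p y) • (coeff n E x y * coeff 1 T i j) -
      sgn ((p i + p j) * p x) • (coeff 1 T i j * coeff n E x y) =
      if y = i then sgn (p i * p j) • coeff n E x j else 0 := by
    rw [key]
    abel
  rw [scomm, e, mul_smul, ← one_smul ℂ (coeff n E x y * _), ← sgn_mul_self ((p i + p j) * p y),
    mul_smul, ← smul_sub, key', smul_ite, smul_zero, mul_smul]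

/-- The supercommutator of `t_{ij}^{(1)}` with the last block column of `E⁻¹`. -/
theorem scomm_t_one_upper_inv (hG : IsGauss blk T F D E) (hT : IsRTT p T) {m : ℕ}
    (hm : ∀ x, blk x ≤ m) {T' E' : PowerSeries (Matrix ι ι A)} (h₁ : T * T' = 1)
    (h₂ : T' * T = 1) (hE₁ : E * E' = 1) (hE₂ : E' * E = 1) {i j x y : ι}
    (hi : blk i < m) (hj : blk j < m) (hy : blk y = m) (n : ℕ) :
    scomm (sgn ((p i + p j) * (p x + p y))) (coeff 1 T i j) (coeff n E' x y) =
      if x = j then (sgn ((p i + p j) * p x) * sgn (p i * p j)) • coeff n E' i y else 0 := by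
  have hK : Commute (twist p (p i + p j) (coeff 1 T i j) - matUnit A (sgn (p i * p j)) j i)
      (proj A (blk · = m)) := by
    apply (commute_twist_proj _ p _ _).sub_left
    rw [Commute, SemiconjBy, proj_mul_matUnit _ _ _ (by lia), matUnit_mul_proj _ _ _ (by lia)]
  have hyT' : Commute (twist p (p i + p j) (coeff 1 T i j) - matUnit A (sgn (p i * p j)) j i)
      T' := by
    have : Commute _ ((⟨T, T', h₁, h₂⟩ : (PowerSeries (Matrix ι ι A))ˣ) :
      PowerSeries (Matrix ι ι A)) := hT.commute_twist_one i j
    exact this.units_inv_right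
  have hone : proj A (fun _ : ι => True) = 1 := by simp [proj]
  have := hG.commute_column (fun _ => True) hm hT.const h₁ h₂ hE₁ hE₂ hK
    ((hK.mul_right hyT').mul_right hK)
    (((by rw [hone]; exact Commute.one_right _ : Commute _ _).mul_right hyT').mul_right hK)
  rw [hone, one_mul, Commute, SemiconjBy] at this
  have key := series_congr this n x y
  have hyi : y ≠ i := by
    rintro rfl
    exact hi.ne hy
  simp only [sub_mul, mul_sub, map_sub, Matrix.sub_apply, coeff_twist_mul, coeff_mul_twist,
    coeff_matUnit_mul, coeff_mul_matUnit, coeff_mul_proj, if_pos hy, if_neg hyi, sub_zero] at key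
  have e : sgn ((p i + p j) * (p x + p y)) =
      sgn ((p i + p j) * p x) * sgn ((p i + p j) * p y) := by
    rw [← sgn_add, mul_add]
  have key' : sgn ((p i + p j) * p x) • (coeff 1 T i j * coeff n E' x y) -
      sgn ((p i + p j) * p y) • (coeff n E' x y * coeff 1 T i j) =
      if x = j then sgn (p i * p j) • coeff n E' i y else 0 := by
    rw [← key]
    abel
  rw [scomm, e, mul_smul, ← one_smul ℂ (_ * coeff n E' x y), ← sgn_mul_self ((p i + p j) * p x),
    mul_smul, ← smul_sub, key', smul_ite, smul_zero, mul_smul]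

/-- Entries of `E(u)` and of `E(v)⁻¹` in suitable blocks supercommute. -/
theorem upper_mul_upper_inv (hG : IsGauss blk T F D E) (hT : IsRTT p T) {m : ℕ}
    (hm : ∀ x, blk x ≤ m) {T' E' : PowerSeries (Matrix ι ι A)} (h₁ : T * T' = 1)
    (h₂ : T' * T = 1) (hE₁ : E * E' = 1) (hE₂ : E' * E = 1) {x y h k : ι}
    (hxh : blk x < blk h) (hyh : blk y ≠ blk h) (hym : blk y ≠ m) (hk : blk k = m)
    (hxm : blk x ≠ m) (r s : ℕ) :
    coeff r E x y * coeff s E' h k =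
      sgn ((p x + p y) * (p h + p k)) • (coeff s E' h k * coeff r E x y) := by
  have hTE : ∀ i j, blk i ≤ blk x → (blk j ≤ blk x ∨ blk j = blk y) → ∀ n,
      coeff n T i j * coeff s E' h k =
        sgn ((p i + p j) * (p h + p k)) • (coeff s E' h k * coeff n T i j) := by
    intro i j hi hj n
    have hxm' := hm x
    have := hG.commute_column (blk · = blk h) hm hT.const h₁ h₂ hE₁ hE₂
      (commute_twist_proj _ p (p i + p j) (coeff n T i j))
      (hT.commute_twist_inv _ _ h₁ h₂ (by lia) (by lia) n)
      (hT.commute_twist_inv _ _ h₁ h₂ (by lia) (by lia) n)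
    exact (commute_twist_compression_iff _ _ p _ _ _).1 this s h k rfl hk
  have hcomm : ∀ (t : ι → Prop) [DecidablePred t], (∀ j, t j → blk j ≤ blk x ∨ blk j = blk y) →
      Commute (twist p (p h + p k) (coeff s E' h k)) (proj A (blk · ≤ blk x) * T * proj A t) := by
    intro t _ ht
    rw [commute_twist_compression_iff]
    intro n i j hi hj
    rw [hTE i j hi (ht j hj) n, ← mul_smul, mul_comm (p h + p k), sgn_mul_self, one_smul]
  have := hG.commute_row (blk · = blk y) (commute_twist_proj _ p _ _) (commute_twist_proj _ p _ _)
    (hcomm _ fun j hj => Or.inl hj) (hcomm _ fun j hj => Or.inr hj)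
  rw [(commute_twist_compression_iff _ _ p _ _ _).1 this r x y rfl rfl, ← mul_smul,
    mul_comm (p h + p k), sgn_mul_self, one_smul]

theorem upper_inv_eq_neg (hG : IsGauss blk T F D E) {m : ℕ} (hm : ∀ x, blk x ≤ m)
    {E' : PowerSeries (Matrix ι ι A)} (hE₁ : E * E' = 1) {x y : ι} (hx : blk x + 1 = m)
    (hy : blk y = m) (n : ℕ) : coeff n E' x y = -coeff n E x y := by
  have hxm : blk x ≠ m := by lia
  have hKE : proj A (blk · = m) * E = proj A (blk · = m) := by
    have := compression_congr (A := A) (blk · = m) (fun _ => True) (f := E) (g := 1)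
      fun n x y hx _ => hG.upper n x y (hx ▸ hm y)
    simpa [proj] using this
  have hKE' : proj A (blk · = m) * E' = proj A (blk · = m) := by
    conv_lhs => rw [← hKE]
    rw [mul_assoc, hE₁, mul_one]
  have hH : proj A (blk · = blk x) * E =
      proj A (blk · = blk x) + proj A (blk · = blk x) * E * proj A (blk · = m) := by
    apply series_ext
    intro n i j
    rw [map_add, Matrix.add_apply, coeff_mul_proj, coeff_proj_mul]
    have h1 : coeff n (proj A (blk · = blk x)) i j =
        if blk i = blk x then coeff n (1 : PowerSeries (Matrix ι ι A)) i j else 0 := by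
      rw [← coeff_proj_mul (blk · = blk x), mul_one]
    rw [h1]
    have := hm j
    split_ifs with hi hj
    · rw [coeff_one_of_ne (by rintro rfl; lia), zero_add]
    · rw [hG.upper n i j (by lia), add_zero]
    · simp
    · simp
  have key := congr_arg (· * E') hH
  simp only [mul_assoc, add_mul, hE₁, hKE', mul_one] at key
  have := series_congr key n x y
  have h0 : coeff n (proj A (blk · = blk x)) x y = 0 := by
    rw [← mul_one (proj A _), coeff_proj_mul, coeff_one_of_ne (by rintro rfl; lia), ite_self]
  simp only [map_add, Matrix.add_apply, coeff_proj_mul, coeff_mul_proj, h0, hy, if_true] at this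
  exact eq_neg_of_add_eq_zero_left this.symm

/-- The first coefficients of `T` and `E` agree above the block diagonal. -/
theorem coeff_one_eq (hG : IsGauss blk T F D E) {x y : ι} (hxy : blk x < blk y) :
    coeff 1 T x y = coeff 1 E x y := by
  have h0 : ∀ f : PowerSeries (Matrix ι ι A), coeff 0 f = constantCoeff f := fun f => by
    rw [coeff_zero_eq_constantCoeff_apply]
  have hne : x ≠ y := by
    rintro rfl
    exact hxy.false
  rw [hG.eq]
  simp [coeff_mul, Finset.Nat.antidiagonal_succ, h0, hG.const_F, hG.const_D,
    hG.const_E, hG.diag 1 x y hxy.ne, hG.lower 1 x y hxy.le, coeff_one_of_ne hne]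

/-- The super Serre relation for a block Gauss decomposition whose last block is `a + 3`. -/
theorem serre (hG : IsGauss blk T F D E) (hT : IsRTT p T) {a : ℕ} (hm : ∀ x, blk x ≤ a + 3)
    {i f1 f2 j h g1 g2 k : ι} (hi : blk i = a) (hf2 : blk f2 = a + 1)
    (hj : blk j = a + 2) (hh : blk h = a + 1) (hg1 : blk g1 = a + 2) (hg2 : blk g2 = a + 2)
    (hk : blk k = a + 3) (r s : ℕ) :
    scomm (sgn ((p i + p f1 + p f2 + p j) * (p h + p g1 + p g2 + p k)))
      (scomm (sgn ((p i + p f1) * (p f2 + p j))) (coeff r E i f1) (coeff 1 E f2 j))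
      (scomm (sgn ((p h + p g1) * (p g2 + p k))) (coeff 1 E h g1) (coeff s E g2 k)) = 0 := by
  obtain ⟨u, hu⟩ := isUnit_of_constantCoeff_eq_one hT.const
  obtain ⟨e, he⟩ := isUnit_of_constantCoeff_eq_one hG.const_E
  have h₁ : T * ↑u⁻¹ = 1 := by rw [← hu, Units.mul_inv]
  have h₂ : ↑u⁻¹ * T = 1 := by rw [← hu, Units.inv_mul]
  have hE₁ : E * ↑e⁻¹ = 1 := by rw [← he, Units.mul_inv]
  have hE₂ : ↑e⁻¹ * E = 1 := by rw [← he, Units.inv_mul]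
  have hneg : coeff s E g2 k = -coeff s (↑e⁻¹ : PowerSeries (Matrix ι ι A)) g2 k := by
    rw [hG.upper_inv_eq_neg hm hE₁ (by lia) hk, neg_neg]
  have hscomm_neg : ∀ (c : ℂ) (x y : A), scomm c x (-y) = -scomm c x y := fun c x y => by
    simp only [scomm, mul_neg, neg_mul, smul_neg]
    abel
  rw [← hG.coeff_one_eq (x := f2) (by lia), ← hG.coeff_one_eq (x := h) (by lia), hneg, hscomm_neg,
    hG.scomm_upper_t_one p hT (by lia) (by lia),
    hG.scomm_t_one_upper_inv p hT hm h₁ h₂ hE₁ hE₂ (by lia) (by lia) hk]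
  by_cases hf : f1 = f2
  · by_cases hg : g2 = g1
    · subst hf hg
      have e1 : p i + p f1 + p f1 + p j = p i + p j := by
        rw [add_assoc (p i), CharTwo.add_self_eq_zero, add_zero]
      have e2 : p h + p g2 + p g2 + p k = p h + p k := by
        rw [add_assoc (p h), CharTwo.add_self_eq_zero, add_zero]
      have key := hG.upper_mul_upper_inv p hT hm h₁ h₂ hE₁ hE₂ (x := i) (y := j) (h := h) (k := k)
        (by lia) (by lia) (by lia) hk (by lia) r s
      rw [e1, e2, if_pos rfl, if_pos rfl, hscomm_neg, neg_eq_zero, scomm, smul_mul_smul_comm,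
        smul_mul_smul_comm, key, smul_comm, mul_comm (sgn _ * sgn _), sub_self]
    · simp [scomm, hg]
  · simp [scomm, hf]

end IsGauss

end MatrixSeries

section BlockIndices

theorem off_succ (μ : ℕ → ℕ) (a : ℕ) : off μ (a + 1) = off μ a + μ a :=
  Finset.sum_range_succ _ _

theorem off_mono (μ : ℕ → ℕ) : Monotone (off μ) :=
  monotone_nat_of_le_succ fun a => by rw [off_succ]; exact Nat.le_add_right _ _

/-- Positions in the first `N` blocks of the composition `μ`. -/
abbrev Pos (μ : ℕ → ℕ) (N : ℕ) : Type := Σ b : Fin N, Fin (μ b)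

variable {μ : ℕ → ℕ} {N : ℕ}

/-- The index in `ℕ` of a position. -/
def Pos.idx (x : Pos μ N) : ℕ := off μ x.1 + x.2

theorem Pos.idx_lt_off (x : Pos μ N) {b : ℕ} (h : (x.1 : ℕ) < b) : x.idx < off μ b := by
  have h1 := off_mono μ (Nat.succ_le_of_lt h)
  have h2 := off_succ μ x.1
  have h3 := x.2.isLt
  rw [Pos.idx]
  lia

theorem Pos.idx_injective : Function.Injective (Pos.idx : Pos μ N → ℕ) := by
  have key : ∀ x y : Pos μ N, (x.1 : ℕ) < y.1 → x.idx < y.idx := fun x y h =>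
    (x.idx_lt_off h).trans_le (Nat.le_add_right _ _)
  rintro ⟨b, i⟩ ⟨c, j⟩ h
  rcases lt_trichotomy b c with hbc | rfl | hbc
  · exact absurd h (key ⟨b, i⟩ ⟨c, j⟩ hbc).ne
  · simp only [Pos.idx, Nat.add_left_cancel_iff] at h
    rw [Fin.ext h]
  · exact absurd h (key ⟨c, j⟩ ⟨b, i⟩ hbc).ne'

theorem Pos.sum_eq {M : Type*} [AddCommMonoid M] (f : ℕ → ℕ → M) :
    ∑ x : Pos μ N, f x.1 x.2 = ∑ c ∈ Finset.range N, ∑ q ∈ Finset.range (μ c), f c q := by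
  rw [Fintype.sum_sigma, Finset.sum_range]
  simp only [Finset.sum_range]

variable [Ring A] [Algebra ℂ A] {d n : ℕ} {p : ℕ → ZMod 2}

/-- The two-term form of the RTT relations. -/
theorem RTT.two_term (S : RTT A d p) {i j h k : ℕ} (hi : i < d) (hj : j < d) (hh : h < d)
    (hk : k < d) (r s : ℕ) :
    scomm (sgn ((p i + p j) * (p h + p k))) (S.t i j (r + 1)) (S.t h k s) -
      scomm (sgn ((p i + p j) * (p h + p k))) (S.t i j r) (S.t h k (s + 1)) =
    sgn (p i * p j + p i * p h + p j * p h) •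
      (S.t h j r * S.t i k s - S.t h j s * S.t i k r) := by
  rw [S.rtt i j h k _ _ hi hj hh hk, S.rtt i j h k _ _ hi hj hh hk, ← smul_sub]
  congr 1
  have e1 : r + 1 + s - 1 = r + s := by lia
  have e2 : r + (s + 1) - 1 = r + s := by lia
  rw [e1, e2]
  rcases lt_trichotomy r s with h | rfl | h
  · rw [min_eq_left (by lia : r + 1 ≤ s), min_eq_left (by lia : r ≤ s + 1),
      Finset.sum_range_succ, add_sub_cancel_left, Nat.add_sub_cancel_left]
  · simp
  · rw [min_eq_right (by lia : s ≤ r + 1), min_eq_right (by lia : s + 1 ≤ r),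
      Finset.sum_range_succ, sub_add_cancel_left, Nat.add_sub_cancel, neg_sub]

/-- The matrix of power series with coefficients `t x y r`. -/
def series (t : Pos μ N → Pos μ N → ℕ → A) : PowerSeries (Matrix (Pos μ N) (Pos μ N) A) :=
  PowerSeries.mk fun r => Matrix.of fun x y => t x y r

@[simp]
theorem coeff_series (t : Pos μ N → Pos μ N → ℕ → A) (r : ℕ) (x y : Pos μ N) :
    coeff r (series t) x y = t x y r := by
  simp [series]

theorem constantCoeff_series {t : Pos μ N → Pos μ N → ℕ → A}
    (h : ∀ x y, t x y 0 = if x = y then 1 else 0) : constantCoeff (series t) = 1 := by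
  rw [← coeff_zero_eq_constantCoeff_apply]
  ext x y
  rw [coeff_series, h, Matrix.one_apply]

theorem series_eq_one_of {t : Pos μ N → Pos μ N → ℕ → A} {r : ℕ} {x y : Pos μ N}
    (h : t x y r = if x = y ∧ r = 0 then 1 else 0) :
    coeff r (series t) x y =
      coeff r (1 : PowerSeries (Matrix (Pos μ N) (Pos μ N) A)) x y := by
  rw [coeff_series, h, coeff_one]
  by_cases hr : r = 0 <;> simp [hr, Matrix.one_apply]

theorem RTT.isRTT_series (S : RTT A d p) (hd : off μ N ≤ d) :
    IsRTT (fun x : Pos μ N => p x.idx) (series fun x y => S.t x.idx y.idx) where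
  const := constantCoeff_series fun x y => by
    rw [S.t_zero]
    simp only [Pos.idx_injective.eq_iff]
  rel i j h k r s := by
    have hlt : ∀ x : Pos μ N, x.idx < d := fun x => (x.idx_lt_off x.1.isLt).trans_le hd
    simp only [coeff_series]
    exact S.two_term (hlt i) (hlt j) (hlt h) (hlt k) r s

theorem Gauss.decomp_le {T : ℕ → ℕ → ℕ → A} (G : Gauss T n μ) (hN : N ≤ n) {a b i j : ℕ}
    (r : ℕ) (ha : a < N) (hb : b < N) (hi : i < μ a) (hj : j < μ b) :
    T (off μ a + i) (off μ b + j) r =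
      ∑ c ∈ Finset.range N, ∑ q1 ∈ Finset.range (μ c), ∑ q2 ∈ Finset.range (μ c),
        ∑ e1 ∈ Finset.range (r + 1), ∑ e2 ∈ Finset.range (r + 1 - e1),
          G.F a c i q1 e1 * G.D c q1 q2 e2 * G.E c b q2 j (r - e1 - e2) := by
  rw [G.decomp a b i j r (by lia) (by lia) hi hj]
  symm
  apply Finset.sum_subset (Finset.range_subset_range.2 hN)
  intro c _ hc
  have hac : a < c := by
    rw [Finset.mem_range] at hc
    lia
  simp [G.F_high a c _ _ _ hac]

theorem Gauss.isGauss_series {T : ℕ → ℕ → ℕ → A} (G : Gauss T n μ) (hN : N ≤ n) :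
    IsGauss (fun x : Pos μ N => (x.1 : ℕ)) (series fun x y => T x.idx y.idx)
      (series fun x y => G.F x.1 y.1 x.2 y.2)
      (series fun x y r => if (x.1 : ℕ) = y.1 then G.D x.1 x.2 y.2 r else 0)
      (series fun x y => G.E x.1 y.1 x.2 y.2) := by
  have hext : ∀ x y : Pos μ N, x = y ↔ (x.1 : ℕ) = y.1 ∧ (x.2 : ℕ) = y.2 := by
    rintro ⟨b, i⟩ ⟨c, j⟩
    constructor
    · rintro ⟨⟩
      exact ⟨rfl, rfl⟩
    · rintro ⟨h1, h2⟩
      obtain rfl := Fin.ext h1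
      obtain rfl := Fin.ext h2
      rfl
  have hF : ∀ (r : ℕ) (x y : Pos μ N), (x.1 : ℕ) ≤ y.1 →
      G.F x.1 y.1 x.2 y.2 r = if x = y ∧ r = 0 then 1 else 0 := by
    intro r x y h
    rcases h.lt_or_eq with h | h
    · rw [G.F_high _ _ _ _ _ h, if_neg]
      rintro ⟨rfl, -⟩
      exact h.false
    · have e : G.F x.1 y.1 x.2 y.2 r = G.F x.1 x.1 x.2 y.2 r :=
        congrArg (fun b => G.F x.1 b x.2 y.2 r) h.symm
      rw [e, G.F_diag]
      simp only [hext, h, true_and]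
  have hE : ∀ (r : ℕ) (x y : Pos μ N), (y.1 : ℕ) ≤ x.1 →
      G.E x.1 y.1 x.2 y.2 r = if x = y ∧ r = 0 then 1 else 0 := by
    intro r x y h
    rcases h.lt_or_eq with h | h
    · rw [G.E_low _ _ _ _ _ h, if_neg]
      rintro ⟨rfl, -⟩
      exact h.false
    · have e : G.E x.1 y.1 x.2 y.2 r = G.E x.1 x.1 x.2 y.2 r :=
        congrArg (fun b => G.E x.1 b x.2 y.2 r) h
      rw [e, G.E_diag]
      simp only [hext, h, true_and]
  refine ⟨?_, constantCoeff_series ?_, constantCoeff_series ?_, constantCoeff_series ?_, ?_, ?_,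
    ?_⟩
  · apply series_ext
    intro r x y
    rw [coeff_series, mul_assoc, coeff_mul, Finset.Nat.sum_antidiagonal_eq_sum_range_succ_mk,
      Pos.idx, Pos.idx, G.decomp_le hN r x.1.isLt y.1.isLt x.2.isLt y.2.isLt]
    have hinner : ∀ e1 ∈ Finset.range r.succ,
        (coeff e1 (series fun x y : Pos μ N => G.F x.1 y.1 x.2 y.2) *
          coeff (r - e1)
            ((series fun x y : Pos μ N => fun r =>
              if (x.1 : ℕ) = y.1 then G.D x.1 x.2 y.2 r else 0) *
              series fun x y : Pos μ N => G.E x.1 y.1 x.2 y.2)) x y =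
        ∑ c ∈ Finset.range N, ∑ q1 ∈ Finset.range (μ c), ∑ q2 ∈ Finset.range (μ c),
          ∑ e2 ∈ Finset.range (r + 1 - e1),
          G.F x.1 c x.2 q1 e1 * G.D c q1 q2 e2 * G.E c y.1 q2 y.2 (r - e1 - e2) := by
      intro e1 he1
      have he : r + 1 - e1 = (r - e1).succ := by
        rw [Finset.mem_range] at he1
        lia
      rw [coeff_mul, Finset.Nat.sum_antidiagonal_eq_sum_range_succ_mk, Matrix.mul_apply, he]
      simp only [Matrix.sum_apply, Matrix.mul_apply, coeff_series, ite_mul, zero_mul]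
      rw [Pos.sum_eq fun c q1 => G.F x.1 c x.2 q1 e1 * ∑ e2 ∈ Finset.range (r - e1).succ,
        ∑ v : Pos μ N, if c = v.1 then
          G.D c q1 v.2 e2 * G.E v.1 y.1 v.2 y.2 (r - e1 - e2) else 0]
      refine Finset.sum_congr rfl fun c hc => Finset.sum_congr rfl fun q1 _ => ?_
      have hsum : ∀ e2, (∑ v : Pos μ N, if c = v.1 then
          G.D c q1 v.2 e2 * G.E v.1 y.1 v.2 y.2 (r - e1 - e2) else 0) =
          ∑ q2 ∈ Finset.range (μ c), G.D c q1 q2 e2 * G.E c y.1 q2 y.2 (r - e1 - e2) := by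
        intro e2
        rw [Pos.sum_eq fun c' q2 => if c = c' then
          G.D c q1 q2 e2 * G.E c' y.1 q2 y.2 (r - e1 - e2) else 0]
        rw [Finset.sum_eq_single_of_mem c hc]
        · simp
        · intro c' _ hne
          simp [hne.symm]
      simp only [hsum, Finset.mul_sum, mul_assoc]
      rw [Finset.sum_comm]
    rw [Matrix.sum_apply, Finset.sum_congr rfl hinner]
    rw [Finset.sum_comm]
    apply Finset.sum_congr rfl
    intro c _
    rw [Finset.sum_comm (s := Finset.range r.succ)]
    apply Finset.sum_congr rfl
    intro q1 _
    exact Finset.sum_comm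
  · intro x y
    rcases le_or_gt (x.1 : ℕ) y.1 with h | h
    · simpa using hF 0 x y h
    · rw [G.F_zero _ _ _ _ h, if_neg]
      rintro rfl
      exact h.false
  · intro x y
    by_cases h : (x.1 : ℕ) = y.1
    · rw [if_pos h, G.D_zero]
      simp only [hext, h, true_and]
    · rw [if_neg h, if_neg]
      rintro rfl
      exact h rfl
  · intro x y
    rcases le_or_gt (y.1 : ℕ) x.1 with h | h
    · simpa using hE 0 x y h
    · rw [G.E_zero _ _ _ _ h, if_neg]
      rintro rfl
      exact h.false
  · exact fun r x y h => series_eq_one_of (hF r x y h)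
  · exact fun r x y h => series_eq_one_of (hE r x y h)
  · intro r x y h
    rw [coeff_series, if_neg h]

end BlockIndices

/-- For a composition `μ` of `M + N` with `n ≥ 4` parts, the super
Serre relation
`[[E_{a;i,f₁}^{(r)}, E_{a+1;f₂,j}^{(1)}], [E_{a+1;h,g₁}^{(1)}, E_{a+2;g₂,k}^{(s)}]] = 0`
holds for all `0 ≤ a ≤ n - 4` (0-based), all `r, s ≥ 1` and all admissible indices,
where `E_a := E_{a,a+1}` are the Gauss blocks and brackets are supercommutators. -/
theorem statement13 [Ring A] [Algebra ℂ A] {d n : ℕ} {p : ℕ → ZMod 2} {μ : ℕ → ℕ}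
    (S : RTT A d p) (G : Gauss S.t n μ) (hd : off μ n = d) (hn : 4 ≤ n) :
    ∀ a i f1 f2 j h g1 g2 k r s : ℕ, a + 4 ≤ n →
      i < μ a → f1 < μ (a + 1) → f2 < μ (a + 1) → h < μ (a + 1) →
      g1 < μ (a + 2) → g2 < μ (a + 2) → j < μ (a + 2) → k < μ (a + 3) →
      1 ≤ r → 1 ≤ s →
      scomm
        (sgn ((p (off μ a + i) + p (off μ (a + 1) + f1) +
               p (off μ (a + 1) + f2) + p (off μ (a + 2) + j)) *
              (p (off μ (a + 1) + h) + p (off μ (a + 2) + g1) +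
               p (off μ (a + 2) + g2) + p (off μ (a + 3) + k))))
        (scomm (sgn ((p (off μ a + i) + p (off μ (a + 1) + f1)) *
              (p (off μ (a + 1) + f2) + p (off μ (a + 2) + j))))
          (G.E a (a + 1) i f1 r) (G.E (a + 1) (a + 2) f2 j 1))
        (scomm (sgn ((p (off μ (a + 1) + h) + p (off μ (a + 2) + g1)) *
              (p (off μ (a + 2) + g2) + p (off μ (a + 3) + k))))
          (G.E (a + 1) (a + 2) h g1 1) (G.E (a + 2) (a + 3) g2 k s)) = 0 := by
  intro a i f1 f2 j h g1 g2 k r s ha hi hf1 hf2 hh hg1 hg2 hj hk _ _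
  have hoff : off μ (a + 4) ≤ d := hd ▸ off_mono μ ha
  simpa only [coeff_series, Pos.idx] using
    (G.isGauss_series ha).serre _ (S.isRTT_series hoff)
      (fun x => Nat.le_of_lt_succ x.1.isLt)
      (i := ⟨⟨a, by lia⟩, ⟨i, hi⟩⟩) (f1 := ⟨⟨a + 1, by lia⟩, ⟨f1, hf1⟩⟩)
      (f2 := ⟨⟨a + 1, by lia⟩, ⟨f2, hf2⟩⟩) (j := ⟨⟨a + 2, by lia⟩, ⟨j, hj⟩⟩)
      (h := ⟨⟨a + 1, by lia⟩, ⟨h, hh⟩⟩) (g1 := ⟨⟨a + 2, by lia⟩, ⟨g1, hg1⟩⟩)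
      (g2 := ⟨⟨a + 2, by lia⟩, ⟨g2, hg2⟩⟩) (k := ⟨⟨a + 3, by lia⟩, ⟨k, hk⟩⟩)
      rfl rfl rfl rfl rfl rfl rfl r s

end SuperYangian
end
end
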